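/- Let k be an odd positive integer. If the multigraph G is odd-(3k−2)-edge-connected or contains 2k−2 edge-disjoint spanning trees, then G can be edge-decomposed into k spanning subgraphs G_1, …, G_k such that for each vertex v and each i, d_{G_i}(v) ≡ d_G(v) (mod 2) and |d_{G_i}(v) − d_G(v)/k| < 2. -/

import Mathlib

open Finset

variable {V E : Type*}

/-- Degree of `v` in the sub-multigraph given by the edge set `S`,
where `ends e` gives the two endpoints of edge `e` (loops count twice). -/
def mdeg [DecidableEq V] (ends : E → V × V) (S : Finset E) (v : V) : ℕ :=
  (S.filter fun e => (ends e).1 = v).card + (S.filter fun e => (ends e).2 = v).card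

/-- Number of edges with exactly one end in the vertex set `X`. -/
def cutCard [Fintype E] [DecidableEq V] (ends : E → V × V) (X : Finset V) : ℕ :=
  (univ.filter fun e : E =>
    ((ends e).1 ∈ X ∧ (ends e).2 ∉ X) ∨ ((ends e).1 ∉ X ∧ (ends e).2 ∈ X)).card

/-- `lam`-edge-connectedness: every edge cut has at least `lam` edges. -/
def EdgeConn [Fintype V] [Fintype E] [DecidableEq V] (ends : E → V × V) (lam : ℕ) : Prop :=
  ∀ X : Finset V, X.Nonempty → X ≠ univ → lam ≤ cutCard ends X

/-- The edge set `T` is a spanning tree: it connects all vertices and has `|V| - 1` edges. -/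
def IsSpanningTree [Fintype V] [DecidableEq V] (ends : E → V × V) (T : Finset E) : Prop :=
  (∀ a b : V,
    Relation.ReflTransGen (fun u w => ∃ e ∈ T, ends e = (u, w) ∨ ends e = (w, u)) a b) ∧
  T.card + 1 = Fintype.card V

/-- `m`-tree-connectedness: there are `m` pairwise edge-disjoint spanning trees. -/
def TreeConn [Fintype V] [DecidableEq V] (ends : E → V × V) (m : ℕ) : Prop :=
  ∃ Ts : Fin m → Finset E,
    (∀ i j, i ≠ j → Disjoint (Ts i) (Ts j)) ∧ ∀ i, IsSpanningTree ends (Ts i)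

set_option linter.unusedSectionVars false
namespace PF
variable {V E : Type*} [DecidableEq V] [DecidableEq E]

/-- distance from `x` to the nearest multiple of `2k` -/
def nrm (k x : ℤ) : ℤ := min (x % (2 * k)) (2 * k - x % (2 * k))

lemma nrm_le {k : ℤ} (hk : 0 < k) (x q : ℤ) : nrm k x ≤ |x - 2 * k * q| := by
  have h1 := Int.emod_nonneg x (show (2 * k) ≠ 0 by omega)
  have h2 := Int.emod_lt_of_pos x (show 0 < 2 * k by omega)
  have h3 := Int.emod_add_mul_ediv x (2 * k)
  set r := x % (2 * k)
  set d := x / (2 * k)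
  have h4 : x - 2 * k * q = r + 2 * k * (d - q) := by rw [← h3]; ring
  rw [h4]
  unfold nrm
  rcases le_or_gt 0 (d - q) with h | h
  · have : 0 ≤ 2 * k * (d - q) := by positivity
    exact le_trans (min_le_left _ _) (le_trans (by omega) (le_abs_self _))
  · have : 2 * k * (d - q) ≤ 2 * k * (-1) := by
      apply mul_le_mul_of_nonneg_left <;> omega
    exact le_trans (min_le_right _ _) (le_trans (by omega) (neg_le_abs _))

lemma nrm_ex {k : ℤ} (hk : 0 < k) (x : ℤ) : ∃ q, nrm k x = |x - 2 * k * q| := by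
  have h1 := Int.emod_nonneg x (show (2 * k) ≠ 0 by omega)
  have h2 := Int.emod_lt_of_pos x (show 0 < 2 * k by omega)
  have h3 := Int.emod_add_mul_ediv x (2 * k)
  unfold nrm
  set r := x % (2 * k)
  set d := x / (2 * k)
  rcases le_total r (2 * k - r) with h | h
  · refine ⟨d, ?_⟩
    rw [min_eq_left h, abs_of_nonneg] <;> nlinarith
  · refine ⟨d + 1, ?_⟩
    rw [min_eq_right h, abs_of_nonpos] <;> nlinarith

lemma nrm_nonneg {k : ℤ} (hk : 0 < k) (x : ℤ) : 0 ≤ nrm k x := by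
  obtain ⟨q, h⟩ := nrm_ex hk x
  rw [h]; positivity

lemma nrm_le_k {k : ℤ} (x : ℤ) : nrm k x ≤ k := by
  unfold nrm; omega

lemma nrm_le_abs {k : ℤ} (hk : 0 < k) (x : ℤ) : nrm k x ≤ |x| := by
  simpa using nrm_le hk x 0

lemma nrm_neg {k : ℤ} (hk : 0 < k) (x : ℤ) : nrm k (-x) = nrm k x := by
  apply le_antisymm
  · obtain ⟨q, h⟩ := nrm_ex hk x
    rw [h, ← abs_neg, show -(x - 2 * k * q) = -x - 2 * k * (-q) by ring]
    exact nrm_le hk _ _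
  · obtain ⟨q, h⟩ := nrm_ex hk (-x)
    rw [h, ← abs_neg, show -(-x - 2 * k * q) = x - 2 * k * (-q) by ring]
    exact nrm_le hk _ _

lemma nrm_add {k : ℤ} (hk : 0 < k) (x y : ℤ) : nrm k (x + y) ≤ nrm k x + nrm k y := by
  obtain ⟨q, h⟩ := nrm_ex hk x
  obtain ⟨q', h'⟩ := nrm_ex hk y
  rw [h, h']
  refine le_trans (nrm_le hk _ (q + q')) (le_trans (le_of_eq ?_) (abs_add_le _ _))
  congr 1; ring

lemma nrm_add_abs {k : ℤ} (hk : 0 < k) (x y : ℤ) : nrm k (x + y) ≤ nrm k x + |y| :=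
  le_trans (nrm_add hk x y) (by have := nrm_le_abs hk y; omega)

lemma nrm_congr {k x y : ℤ} (h : 2 * k ∣ x - y) : nrm k x = nrm k y := by
  unfold nrm
  rw [Int.emod_emod_of_dvd x (dvd_refl _) |>.symm, (Int.emod_emod_of_dvd y (dvd_refl (2*k))).symm]
  rw [Int.emod_eq_emod_iff_emod_sub_eq_zero.2 (Int.emod_eq_zero_of_dvd h)]

lemma nrm_zero {k : ℤ} (hk : 0 < k) : nrm k 0 = 0 :=
  le_antisymm (by simpa using nrm_le_abs hk 0) (nrm_nonneg hk 0)

lemma nrm_dvd {k x : ℤ} (hk : 0 < k) (h : 2 * k ∣ x) : nrm k x = 0 := by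
  rw [nrm_congr (y := 0) (by simpa using h), nrm_zero hk]

lemma dvd_of_nrm {k x : ℤ} (hk : 0 < k) (h : nrm k x = 0) : 2 * k ∣ x := by
  obtain ⟨q, h'⟩ := nrm_ex hk x
  rw [h] at h'
  exact ⟨q, by have := abs_eq_zero.1 h'.symm; omega⟩

lemma nrm_par {k : ℤ} (hk : 0 < k) (x : ℤ) : 2 ∣ nrm k x - x := by
  obtain ⟨q, h⟩ := nrm_ex hk x
  rw [h]
  rcases abs_choice (x - 2 * k * q) with h | h <;> rw [h]
  · exact ⟨-(k * q), by ring⟩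
  · exact ⟨k * q - x, by ring⟩

/-- signed representative -/
lemma nrm_rep {k : ℤ} (hk : 0 < k) (x : ℤ) : ∃ t, 2 * k ∣ x - t ∧ |t| = nrm k x := by
  obtain ⟨q, h⟩ := nrm_ex hk x
  exact ⟨x - 2 * k * q, ⟨q, by ring⟩, h.symm⟩

lemma nrm_small {k x : ℤ} (hk : 0 < k) (h1 : 0 ≤ x) (h : x ≤ k) : nrm k x = x := by
  unfold nrm
  rw [Int.emod_eq_of_lt h1 (by omega)]; omega

/-- indicator -/
def ch (A : Finset V) (v : V) : ℤ := if v ∈ A then 1 else 0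
def sm (f : V → ℤ) (A : Finset V) : ℤ := ∑ v ∈ A, f v
def pt (x : V) (v : V) : ℤ := if v = x then 1 else 0
def df (ends : E → V × V) (A : Finset V) (e : E) : ℤ := ch A (ends e).1 - ch A (ends e).2
def dc (ends : E → V × V) (F : Finset E) (A : Finset V) : ℤ := ∑ e ∈ F, |df ends A e|
def net (ends : E → V × V) (F : Finset E) (ε : E → ℤ) (A : Finset V) : ℤ :=
  ∑ e ∈ F, ε e * df ends A e
def Joins (ends : E → V × V) (e : E) (x y : V) : Prop := ends e = (x, y) ∨ ends e = (y, x)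

def Sol (k : ℤ) (ends : E → V × V) (F : Finset E) (U : Finset V) (γ : V → ℤ) : Prop :=
  ∃ ε : E → ℤ, (∀ e, ε e = 1 ∨ ε e = -1) ∧ ∀ v ∈ U, 2 * k ∣ γ v - net ends F ε {v}

lemma ch_mem {A : Finset V} {v : V} (h : v ∈ A) : ch A v = 1 := by simp [ch, h]
lemma ch_not {A : Finset V} {v : V} (h : v ∉ A) : ch A v = 0 := by simp [ch, h]
lemma ch_01 (A : Finset V) (v : V) : ch A v = 0 ∨ ch A v = 1 := by
  unfold ch; split_ifs <;> simp
lemma sm_pt (A : Finset V) (x : V) : sm (pt x) A = ch A x := by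
  simp [sm, pt, ch]
lemma ch_sum (A : Finset V) (v : V) : ch A v = ∑ x ∈ A, ch {x} v := by
  simp [ch]
lemma sm_add (f g : V → ℤ) (A : Finset V) : sm (fun v => f v + g v) A = sm f A + sm g A := by
  simp [sm, sum_add_distrib]
lemma sm_sub (f g : V → ℤ) (A : Finset V) : sm (fun v => f v - g v) A = sm f A - sm g A := by
  simp [sm, sum_sub_distrib]
lemma sm_mul (c : ℤ) (g : V → ℤ) (A : Finset V) : sm (fun v => c * g v) A = c * sm g A := by
  simp [sm, mul_sum]
lemma sm_neg (g : V → ℤ) (A : Finset V) : sm (fun v => - g v) A = - sm g A := by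
  simp [sm]
lemma sm_single (f : V → ℤ) (v : V) : sm f {v} = f v := by simp [sm]
lemma sm_nonneg {f : V → ℤ} (h : ∀ v, 0 ≤ f v) (A : Finset V) : 0 ≤ sm f A :=
  sum_nonneg fun v _ => h v
lemma sm_sdiff (f : V → ℤ) {A U : Finset V} (h : A ⊆ U) : sm f (U \ A) = sm f U - sm f A := by
  have := sum_sdiff (f := f) h
  unfold sm; omega
lemma pt_nonneg (x v : V) : 0 ≤ pt x v := by unfold pt; split_ifs <;> simp
lemma pt_self (x : V) : pt x x = 1 := by simp [pt]
lemma pt_ne {x v : V} (h : v ≠ x) : pt x v = 0 := by simp [pt, h]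

lemma df_sum (ends : E → V × V) (A : Finset V) (e : E) : df ends A e = ∑ x ∈ A, df ends {x} e := by
  unfold df; rw [sum_sub_distrib, ← ch_sum, ← ch_sum]

lemma net_sum (ends : E → V × V) (F : Finset E) (ε : E → ℤ) (A : Finset V) :
    net ends F ε A = ∑ x ∈ A, net ends F ε {x} := by
  unfold net
  rw [sum_comm]
  refine sum_congr rfl fun e _ => ?_
  rw [df_sum, mul_sum]

lemma abs_par (x : ℤ) : 2 ∣ |x| - x := by
  rcases abs_choice x with h | h <;> rw [h]
  · simp
  · exact ⟨-x, by ring⟩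

lemma eps_par {ε x : ℤ} (h : ε = 1 ∨ ε = -1) : 2 ∣ ε * x - x := by
  rcases h with rfl | rfl
  · simp
  · exact ⟨-x, by ring⟩

lemma dc_net_par (ends : E → V × V) (F : Finset E) (ε : E → ℤ) (hε : ∀ e, ε e = 1 ∨ ε e = -1)
    (A : Finset V) : 2 ∣ dc ends F A - net ends F ε A := by
  unfold dc net
  rw [← sum_sub_distrib]
  refine dvd_sum fun e _ => ?_
  have h1 := abs_par (df ends A e)
  have h2 := eps_par (x := df ends A e) (hε e)
  omega

lemma dc_par (ends : E → V × V) (F : Finset E) (A : Finset V) :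
    2 ∣ dc ends F A - ∑ v ∈ A, dc ends F {v} := by
  have h : ∀ B, 2 ∣ dc ends F B - net ends F (fun _ => 1) B :=
    fun B => dc_net_par ends F _ (fun _ => Or.inl rfl) B
  have h1 := h A
  rw [net_sum] at h1
  have h2 : 2 ∣ ∑ v ∈ A, (dc ends F {v} - net ends F (fun _ => 1) {v}) :=
    dvd_sum fun v _ => h {v}
  rw [sum_sub_distrib] at h2
  omega

lemma par_set {ends : E → V × V} {F : Finset E} {γ : V → ℤ} {U : Finset V}
    (par : ∀ v ∈ U, 2 ∣ γ v - dc ends F {v}) {A : Finset V} (h : A ⊆ U) :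
    2 ∣ sm γ A - dc ends F A := by
  have h1 := dc_par ends F A
  have h2 : 2 ∣ ∑ v ∈ A, (γ v - dc ends F {v}) := dvd_sum fun v hv => par v (h hv)
  rw [sum_sub_distrib] at h2
  unfold sm; omega

lemma dc_nonneg (ends : E → V × V) (F : Finset E) (A : Finset V) : 0 ≤ dc ends F A :=
  sum_nonneg fun _ _ => abs_nonneg _

lemma joins_df {ends : E → V × V} {e : E} {x y : V} (h : Joins ends e x y) (A : Finset V) :
    |df ends A e| = |ch A x - ch A y| := by
  rcases h with h | h <;> simp [df, h]
  exact abs_sub_comm _ _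

lemma joins_symm {ends : E → V × V} {e : E} {x y : V} (h : Joins ends e x y) :
    Joins ends e y x := h.symm

lemma dc_erase {ends : E → V × V} {F : Finset E} {e : E} {x y : V} (he : e ∈ F)
    (h : Joins ends e x y) (A : Finset V) :
    dc ends (F.erase e) A = dc ends F A - |ch A x - ch A y| := by
  unfold dc
  rw [← joins_df h, ← add_sum_erase F _ he]; ring

/-- find an edge crossing `A` -/
lemma exists_cross {ends : E → V × V} {F : Finset E} {A : Finset V} (h : dc ends F A ≠ 0) :
    ∃ e ∈ F, ∃ x y, Joins ends e x y ∧ x ∈ A ∧ y ∉ A := by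
  obtain ⟨e, he, h1⟩ := exists_ne_zero_of_sum_ne_zero h
  refine ⟨e, he, ?_⟩
  unfold df ch at h1
  by_cases h2 : (ends e).1 ∈ A <;> by_cases h3 : (ends e).2 ∈ A <;> simp [h2, h3] at h1
  · exact ⟨_, _, Or.inl rfl, h2, h3⟩
  · exact ⟨_, _, Or.inr rfl, h3, h2⟩

lemma cross_pos {ends : E → V × V} {F : Finset E} {A : Finset V} {e x y} (he : e ∈ F)
    (h : Joins ends e x y) (hx : x ∈ A) (hy : y ∉ A) : 0 < dc ends F A := by
  have h1 := dc_erase he h A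
  have h2 := dc_nonneg ends (F.erase e) A
  rw [ch_mem hx, ch_not hy] at h1
  norm_num at h1
  omega

lemma dc_univ {ends : E → V × V} {F : Finset E} {U : Finset V}
    (hU : ∀ e ∈ F, (ends e).1 ∈ U ∧ (ends e).2 ∈ U) : dc ends F U = 0 := by
  refine sum_eq_zero fun e he => ?_
  simp [df, ch_mem (hU e he).1, ch_mem (hU e he).2]

lemma dc_compl {ends : E → V × V} {F : Finset E} {U A : Finset V}
    (hU : ∀ e ∈ F, (ends e).1 ∈ U ∧ (ends e).2 ∈ U) : dc ends F (U \ A) = dc ends F A := by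
  refine sum_congr rfl fun e he => ?_
  have h := hU e he
  have : ∀ v ∈ U, ch (U \ A) v = 1 - ch A v := by
    intro v hv; by_cases h : v ∈ A <;> simp [ch, h, hv]
  simp only [df, this _ h.1, this _ h.2]
  rw [abs_sub_comm]; congr 1; ring

lemma joins_mem {ends : E → V × V} {F : Finset E} {U : Finset V}
    (hU : ∀ e ∈ F, (ends e).1 ∈ U ∧ (ends e).2 ∈ U) {e x y} (he : e ∈ F)
    (h : Joins ends e x y) : x ∈ U ∧ y ∈ U := by
  have h1 := hU e he
  rcases h with h | h <;> rw [h] at h1 <;> simp_all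

/-- partial orientation -/
lemma sol_partial {k : ℤ} {ends : E → V × V} {F G : Finset E} {U W : Finset V} {γ γ' : V → ℤ}
    (hG : G ⊆ F) (ε : E → ℤ) (hε : ∀ e, ε e = 1 ∨ ε e = -1)
    (hγ : ∀ v ∈ U, v ∈ W → 2 * k ∣ γ' v - (γ v - net ends G ε {v}))
    (hW : ∀ v ∈ U, v ∉ W → 2 * k ∣ γ v - net ends G ε {v} ∧ ∀ e ∈ F \ G, df ends {v} e = 0)
    (h : Sol k ends (F \ G) W γ') : Sol k ends F U γ := by
  obtain ⟨ε', h1, h2⟩ := h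
  refine ⟨fun e => if e ∈ G then ε e else ε' e, ?_, ?_⟩
  · intro e; dsimp only; split_ifs
    · exact hε e
    · exact h1 e
  · intro v hv
    have h3 : net ends F (fun e => if e ∈ G then ε e else ε' e) {v} =
        net ends (F \ G) ε' {v} + net ends G ε {v} := by
      unfold net
      rw [← sum_sdiff hG]
      congr 1
      · refine sum_congr rfl fun e he => ?_
        simp only [if_neg (mem_sdiff.1 he).2]
      · refine sum_congr rfl fun e he => ?_
        simp only [if_pos he]
    rw [h3]
    by_cases hw : v ∈ W
    · have := dvd_sub (h2 v hw) (hγ v hv hw)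
      rwa [show γ' v - net ends (F \ G) ε' {v} - (γ' v - (γ v - net ends G ε {v})) =
        γ v - (net ends (F \ G) ε' {v} + net ends G ε {v}) by ring] at this
    · have h4 := hW v hv hw
      have h5 : net ends (F \ G) ε' {v} = 0 := sum_eq_zero fun e he => by rw [h4.2 e he, mul_zero]
      rw [h5]; simpa using h4.1

/-- orient one edge `x → y` -/
lemma sol_edge {k : ℤ} {ends : E → V × V} {F : Finset E} {U : Finset V} {γ : V → ℤ} {e : E} {x y : V}
    (he : e ∈ F) (hj : Joins ends e x y)
    (h : Sol k ends (F.erase e) U (fun v => γ v + (pt y v - pt x v))) : Sol k ends F U γ := by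
  rw [← sdiff_singleton_eq_erase] at h
  have hp : ∀ v : V, ch {v} x = pt x v ∧ ch {v} y = pt y v := by
    intro v; simp [ch, pt, eq_comm]
  rcases hj with hj | hj
  · refine sol_partial (G := {e}) (by simpa using he) (fun _ => 1) (fun _ => Or.inl rfl) ?_ ?_ h
    · intro v _ _
      simp [net, df, hj, hp v]
    · intro v h1 h2; exact absurd h1 h2
  · refine sol_partial (G := {e}) (by simpa using he) (fun _ => -1) (fun _ => Or.inr rfl) ?_ ?_ h
    · intro v _ _
      simp [net, df, hj, hp v]
    · intro v h1 h2; exact absurd h1 h2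

/-- lifting `u - v - w` -/
lemma sol_lift {k : ℤ} {ends : E → V × V} {F : Finset E} {U : Finset V} {γ : V → ℤ} {e f : E} {u v w : V}
    (he : e ∈ F) (hf : f ∈ F) (hef : e ≠ f) (h1 : Joins ends e u v) (h2 : Joins ends f v w)
    (h : Sol k (Function.update ends e (u, w)) (F.erase f) U γ) : Sol k ends F U γ := by
  obtain ⟨ε, hε, hs⟩ := h
  -- sign for e and f
  let se : ℤ := if ends e = (u, v) then 1 else -1
  let sf : ℤ := if ends f = (v, w) then 1 else -1
  have hse : ∀ A, se * df ends A e = ch A u - ch A v := by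
    intro A
    rcases h1 with h1 | h1
    · simp [se, df, h1]
    · by_cases h : (v, u) = (u, v)
      · simp only [Prod.mk.injEq] at h; simp [df, h1, h.1]
      · simp [se, df, h1, h]
  have hsf : ∀ A, sf * df ends A f = ch A v - ch A w := by
    intro A
    rcases h2 with h1 | h1
    · simp [sf, df, h1]
    · by_cases h : (w, v) = (v, w)
      · simp only [Prod.mk.injEq] at h; simp [df, h1, h.1]
      · simp [sf, df, h1, h]
  have hse1 : se = 1 ∨ se = -1 := by simp only [se]; split_ifs <;> simp
  have hsf1 : sf = 1 ∨ sf = -1 := by simp only [sf]; split_ifs <;> simp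
  refine ⟨fun g => if g = e then ε e * se else if g = f then ε e * sf else ε g, ?_, ?_⟩
  · intro g; dsimp only
    have := hε e
    split_ifs
    · rcases this with h | h <;> rcases hse1 with h' | h' <;> simp [h, h']
    · rcases this with h | h <;> rcases hsf1 with h' | h' <;> simp [h, h']
    · exact hε g
  · intro x hx
    have h3 := hs x hx
    convert h3 using 2
    unfold net
    rw [← add_sum_erase F _ hf, ← add_sum_erase (F.erase f) _ (mem_erase.2 ⟨hef, he⟩),
      ← add_sum_erase (F.erase f) (fun g => ε g * df (Function.update ends e (u, w)) {x} g)
        (mem_erase.2 ⟨hef, he⟩), ← add_assoc]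
    congr 1
    · simp only [if_neg hef.symm, if_true, mul_assoc, hse, hsf]
      simp [df]; ring
    · refine sum_congr rfl fun g hg => ?_
      simp only [mem_erase] at hg
      simp only [if_neg hg.1, if_neg hg.2.1]
      simp [df, hg.1]

lemma dc_lift {ends : E → V × V} {F : Finset E} {e f : E} {u v w : V}
    (he : e ∈ F) (hf : f ∈ F) (hef : e ≠ f) (h1 : Joins ends e u v) (h2 : Joins ends f v w)
    (A : Finset V) :
    dc (Function.update ends e (u, w)) (F.erase f) A =
      dc ends F A - |ch A u - ch A v| - |ch A v - ch A w| + |ch A u - ch A w| := by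
  unfold dc
  rw [← add_sum_erase F _ hf, ← add_sum_erase (F.erase f) _ (mem_erase.2 ⟨hef, he⟩),
      ← add_sum_erase (F.erase f) (fun g => |df ends A g|)
        (mem_erase.2 ⟨hef, he⟩), joins_df h1, joins_df h2]
  have : ∑ g ∈ (F.erase f).erase e, |df (Function.update ends e (u, w)) A g| =
      ∑ g ∈ (F.erase f).erase e, |df ends A g| := by
    refine sum_congr rfl fun g hg => ?_
    simp only [mem_erase] at hg
    simp [df, hg.1]
  rw [this]
  simp [df]; ring

lemma ends_lift {ends : E → V × V} {F : Finset E} {U : Finset V}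
    (hU : ∀ e ∈ F, (ends e).1 ∈ U ∧ (ends e).2 ∈ U) {e f : E} {u v w : V}
    (he : e ∈ F) (hf : f ∈ F) (h1 : Joins ends e u v) (h2 : Joins ends f v w) :
    ∀ g ∈ F.erase f, (Function.update ends e (u, w) g).1 ∈ U ∧
      (Function.update ends e (u, w) g).2 ∈ U := by
  intro g hg
  by_cases h : g = e
  · subst h; simp [(joins_mem hU he h1).1, (joins_mem hU hf h2).2]
  · simp only [Function.update_of_ne h]
    exact hU g (mem_of_mem_erase hg)

end PF

namespace PF
variable {V E : Type*} [DecidableEq V] [DecidableEq E]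

def vstar (ends : E → V × V) (F : Finset E) (v : V) : Finset E := F.filter fun e => df ends {v} e ≠ 0

lemma df_single (ends : E → V × V) (v : V) (e : E) :
    df ends {v} e = 0 ∨ df ends {v} e = 1 ∨ df ends {v} e = -1 := by
  unfold df
  rcases ch_01 {v} (ends e).1 with h | h <;> rcases ch_01 {v} (ends e).2 with h' | h' <;> simp [h, h']

lemma star_card (ends : E → V × V) (F : Finset E) (v : V) :
    ((vstar ends F v).card : ℤ) = dc ends F {v} := by
  unfold dc vstar
  rw [card_filter]
  push_cast
  refine sum_congr rfl fun e _ => ?_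
  rcases df_single ends v e with h | h | h <;> simp [h]

lemma star_orient (ends : E → V × V) (F : Finset E) (v : V) (t : ℤ) (h1 : |t| ≤ dc ends F {v})
    (h2 : 2 ∣ t - dc ends F {v}) :
    ∃ ε : E → ℤ, (∀ e, ε e = 1 ∨ ε e = -1) ∧ net ends (vstar ends F v) ε {v} = t := by
  rw [← star_card] at h1 h2
  obtain ⟨c, hc⟩ := h2
  rw [abs_le] at h1
  obtain ⟨P, hP, hPc⟩ := exists_subset_card_eq (s := vstar ends F v)
    (n := ((vstar ends F v).card + c).toNat) (by omega)
  have hS : ∀ e ∈ vstar ends F v, df ends {v} e = 1 ∨ df ends {v} e = -1 := by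
    intro e he
    have := (mem_filter.1 he).2
    rcases df_single ends v e with h | h | h
    · exact absurd h this
    · exact Or.inl h
    · exact Or.inr h
  refine ⟨fun e => if e ∈ vstar ends F v then (if e ∈ P then df ends {v} e else - df ends {v} e) else 1,
    ?_, ?_⟩
  · intro e
    dsimp only
    split_ifs with h h'
    · exact hS e h
    · rcases hS e h with h | h <;> simp [h]
    · simp
  · unfold net
    rw [← sum_sdiff hP]
    have e1 : ∑ e ∈ P, (if e ∈ vstar ends F v then (if e ∈ P then df ends {v} e else - df ends {v} e) else 1) *
        df ends {v} e = ∑ e ∈ P, 1 := by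
      refine sum_congr rfl fun e he => ?_
      rw [if_pos (hP he), if_pos he]
      rcases hS e (hP he) with h | h <;> simp [h]
    have e2 : ∑ e ∈ vstar ends F v \ P, (if e ∈ vstar ends F v then (if e ∈ P then df ends {v} e else - df ends {v} e) else 1) *
        df ends {v} e = ∑ e ∈ vstar ends F v \ P, (-1) := by
      refine sum_congr rfl fun e he => ?_
      rw [mem_sdiff] at he
      rw [if_pos he.1, if_neg he.2]
      rcases hS e he.1 with h | h <;> simp [h]
    rw [e1, e2]
    have := card_sdiff_add_card_eq_card hP
    simp only [sum_const, nsmul_eq_mul]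
    omega

structure Cfg (k : ℤ) (ends : E → V × V) (F : Finset E) (U : Finset V) (γ a b : V → ℤ)
    (X : Finset V) : Prop where
  hU : ∀ e ∈ F, (ends e).1 ∈ U ∧ (ends e).2 ∈ U
  par : ∀ v ∈ U, 2 ∣ γ v - dc ends F {v}
  tot : 2 * k ∣ sm γ U
  a0 : ∀ v, 0 ≤ a v
  b0 : ∀ v, 0 ≤ b v
  hX : X = ∅ ∨ ∃ v ∈ U, X = {v} ∧ 2 * k ∣ γ v + a v - b v
  up : sm a U + sm b U ≤ 2 * k - 2 + nrm k (sm a U - sm b U)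
  low : ∀ A ⊆ U, A.Nonempty → A ≠ U → A ≠ X →
    2 * k - 2 + nrm k (sm γ A + sm a A - sm b A) ≤ dc ends F A + sm a A + sm b A

def cmap (A : Finset V) (r v : V) : V := if v ∈ A then r else v
def cends (ends : E → V × V) (A : Finset V) (r : V) (e : E) : V × V :=
  (cmap A r (ends e).1, cmap A r (ends e).2)
def cf (A : Finset V) (r : V) (f : V → ℤ) (v : V) : ℤ := if v = r then sm f A else f v
def pre (A : Finset V) (r : V) (B : Finset V) : Finset V := if r ∈ B then B ∪ A else B

lemma ch_pre {A U B : Finset V} {r : V} (hr : r ∈ A) (hB : B ⊆ insert r (U \ A)) (x : V) :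
    ch B (cmap A r x) = ch (pre A r B) x := by
  have h1 : ∀ y ∈ A, y ∈ B → y = r := by
    intro y hy hyB
    have := hB hyB
    simp only [mem_insert, mem_sdiff] at this
    tauto
  have h2 := h1 x
  have h3 : x = r → x ∈ A := by rintro rfl; exact hr
  by_cases h : x ∈ A <;> by_cases h' : r ∈ B <;> simp only [ch, cmap, pre, h, h', if_true, if_false, mem_union, or_true, or_false]
  have : x ∉ B := fun hx => h' (h2 h hx ▸ hx)
  rw [if_neg this]

lemma dc_pre (ends : E → V × V) (F : Finset E) {A U B : Finset V} {r : V} (hr : r ∈ A)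
    (hB : B ⊆ insert r (U \ A)) : dc (cends ends A r) F B = dc ends F (pre A r B) := by
  unfold dc df cends
  simp only [ch_pre hr hB]

lemma net_pre (ends : E → V × V) (F : Finset E) (ε : E → ℤ) {A U B : Finset V} {r : V} (hr : r ∈ A)
    (hB : B ⊆ insert r (U \ A)) : net (cends ends A r) F ε B = net ends F ε (pre A r B) := by
  unfold net df cends
  simp only [ch_pre hr hB]

lemma sm_cf (f : V → ℤ) {A U B : Finset V} {r : V} (hr : r ∈ A)
    (hB : B ⊆ insert r (U \ A)) : sm (cf A r f) B = sm f (pre A r B) := by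
  have h0 : ∀ C : Finset V, r ∉ C → sm (cf A r f) C = sm f C := by
    intro C hC
    refine sum_congr rfl fun v hv => ?_
    have : v ≠ r := fun h => hC (h ▸ hv)
    simp [cf, this]
  by_cases h : r ∈ B
  · have h1 : pre A r B = B.erase r ∪ A := by
      ext x; simp only [pre, h, if_true, mem_union, mem_erase]
      by_cases hx : x = r
      · subst hx; simp [hr]
      · simp [hx]
    have h2 : Disjoint (B.erase r) A := by
      rw [disjoint_left]
      intro x hx hxA
      have := hB (mem_of_mem_erase hx)
      simp only [mem_insert, mem_sdiff] at this
      simp only [mem_erase] at hx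
      tauto
    have h3 : sm f (B.erase r ∪ A) = sm f (B.erase r) + sm f A := sum_union h2
    have h4 : sm (cf A r f) B = cf A r f r + sm (cf A r f) (B.erase r) := (add_sum_erase B _ h).symm
    rw [h1, h3, h4, h0 _ (notMem_erase r B)]
    simp [cf]; ring
  · rw [h0 B h]; simp [pre, h]

lemma pre_sub {A U B : Finset V} {r : V} (hA : A ⊆ U)
    (hB : B ⊆ insert r (U \ A)) (hr : r ∈ A) : pre A r B ⊆ U := by
  intro x hx
  have h1 : x ∈ B → x ∈ U := by
    intro h; have := hB h; simp only [mem_insert, mem_sdiff] at this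
    rcases this with rfl | h
    · exact hA hr
    · exact h.1
  unfold pre at hx; split_ifs at hx
  · rcases mem_union.1 hx with h | h
    · exact h1 h
    · exact hA h
  · exact h1 hx

lemma pre_nonempty {A B : Finset V} {r : V} (h : B.Nonempty) : (pre A r B).Nonempty := by
  unfold pre; split_ifs
  · exact h.mono subset_union_left
  · exact h

lemma pre_ne {A U B : Finset V} {r : V} (hA : A ⊆ U)
    (hB : B ⊆ insert r (U \ A)) (hr : r ∈ A) (h : B ≠ insert r (U \ A)) : pre A r B ≠ U := by
  intro h1
  apply h
  apply Subset.antisymm hB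
  have hrB : r ∈ B := by
    by_contra hc
    simp only [pre, hc, if_false] at h1
    exact hc (h1 ▸ hA hr)
  simp only [pre, hrB, if_true] at h1
  intro x hx
  simp only [mem_insert, mem_sdiff] at hx
  rcases hx with rfl | ⟨h2, h3⟩
  · exact hrB
  · rw [← h1] at h2
    rcases mem_union.1 h2 with h | h
    · exact h
    · exact absurd h h3

lemma pre_full {A U : Finset V} {r : V} (hA : A ⊆ U) (hr : r ∈ A) : pre A r (insert r (U \ A)) = U := by
  ext x
  simp only [pre, mem_insert_self, if_true, mem_union, mem_insert, mem_sdiff]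
  constructor
  · rintro ((rfl | h) | h)
    · exact hA hr
    · exact h.1
    · exact hA h
  · intro h; by_cases hx : x ∈ A <;> simp [hx, h]

lemma pre_r {A : Finset V} {r : V} (hr : r ∈ A) : pre A r {r} = A := by
  simp [pre, hr]

lemma pre_other {A : Finset V} {r v : V} (hv : v ≠ r) : pre A r {v} = {v} := by
  have : r ≠ v := hv.symm
  simp [pre, this]

lemma ccard {A U : Finset V} {r : V} (hA : A ⊆ U) (hr : r ∈ A) (h2 : 2 ≤ A.card) :
    (insert r (U \ A)).card < U.card := by
  rw [card_insert_of_notMem (by simp [hr])]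
  have := card_sdiff_add_card_eq_card hA
  omega

lemma cends_mem {ends : E → V × V} {F : Finset E} {U A : Finset V} {r : V}
    (hU : ∀ e ∈ F, (ends e).1 ∈ U ∧ (ends e).2 ∈ U) :
    ∀ e ∈ F, (cends ends A r e).1 ∈ insert r (U \ A) ∧ (cends ends A r e).2 ∈ insert r (U \ A) := by
  intro e he
  have := hU e he
  simp only [cends, cmap, mem_insert, mem_sdiff]
  constructor <;> split_ifs with h <;> simp [h, this]

lemma cpar {ends : E → V × V} {F : Finset E} {U A : Finset V} {r : V} {γ : V → ℤ}
    (par : ∀ v ∈ U, 2 ∣ γ v - dc ends F {v}) (hA : A ⊆ U) (hr : r ∈ A) :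
    ∀ v ∈ insert r (U \ A), 2 ∣ cf A r γ v - dc (cends ends A r) F {v} := by
  intro v hv
  have hs : {v} ⊆ insert r (U \ A) := by simpa using hv
  rw [← sm_single (cf A r γ) v, sm_cf γ hr hs, dc_pre ends F hr hs]
  exact par_set par (pre_sub hA hs hr)

lemma net_split {ends : E → V × V} {F G : Finset E} (hG : G ⊆ F) (ε : E → ℤ) (A : Finset V) :
    net ends F ε A = net ends (F \ G) ε A + net ends G ε A := (sum_sdiff hG).symm
lemma dc_split {ends : E → V × V} {F G : Finset E} (hG : G ⊆ F) (A : Finset V) :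
    dc ends F A = dc ends (F \ G) A + dc ends G A := (sum_sdiff hG).symm

lemma extend {k : ℤ} {ends : E → V × V} {F : Finset E} {U A X : Finset V} {γ a b : V → ℤ} {r : V}
    (hLT : ∀ (ends : E → V × V) F γ a b X, Cfg k ends F A γ a b X → Sol k ends F A γ)
    (hU : ∀ e ∈ F, (ends e).1 ∈ U ∧ (ends e).2 ∈ U)
    (par : ∀ v ∈ U, 2 ∣ γ v - dc ends F {v})
    (a0 : ∀ v, 0 ≤ a v) (b0 : ∀ v, 0 ≤ b v)
    (hA : A ⊆ U) (hr : r ∈ A)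
    (hX : X = ∅ ∨ ∃ v ∈ A, X = {v} ∧ 2 * k ∣ γ v + a v - b v)
    (up : dc ends F A + sm a A + sm b A ≤ 2 * k - 2 + nrm k (sm γ A + sm a A - sm b A))
    (low : ∀ B ⊆ A, B.Nonempty → B ≠ A → B ≠ X →
      2 * k - 2 + nrm k (sm γ B + sm a B - sm b B) ≤ dc ends F B + sm a B + sm b B)
    (hs : Sol k (cends ends A r) F (insert r (U \ A)) (cf A r γ)) : Sol k ends F U γ := by
  obtain ⟨ε, hε, hs⟩ := hs
  set G := F.filter fun e => ¬ ((ends e).1 ∈ A ∧ (ends e).2 ∈ A) with hGdef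
  have hGF : G ⊆ F := filter_subset _ _
  have hin : ∀ e ∈ F \ G, (ends e).1 ∈ A ∧ (ends e).2 ∈ A := by
    intro e he
    simp only [hGdef, mem_sdiff, mem_filter] at he
    have := he.1
    have := he.2
    tauto
  have hout : ∀ e ∈ G, ¬ ((ends e).1 ∈ A ∧ (ends e).2 ∈ A) := fun e he => (mem_filter.1 he).2
  have hzero : ∀ v, v ∉ A → ∀ e ∈ F \ G, df ends {v} e = 0 := by
    intro v hv e he
    have h := hin e he
    have h1 : (ends e).1 ∉ ({v} : Finset V) := by
      rw [mem_singleton]; rintro h2; exact hv (h2 ▸ h.1)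
    have h2 : (ends e).2 ∉ ({v} : Finset V) := by
      rw [mem_singleton]; rintro h2; exact hv (h2 ▸ h.2)
    simp [df, ch_not h1, ch_not h2]
  have hzA : ∀ e ∈ F \ G, df ends A e = 0 := by
    intro e he
    have h := hin e he
    simp [df, ch_mem h.1, ch_mem h.2]
  have htA : 2 * k ∣ sm γ A - net ends G ε A := by
    have h := hs r (mem_insert_self _ _)
    have hsub : {r} ⊆ insert r (U \ A) := by simp
    rw [net_pre ends F ε hr hsub, pre_r hr, net_split hGF] at h
    have : net ends (F \ G) ε A = 0 := sum_eq_zero fun e he => by rw [hzA e he, mul_zero]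
    rw [this] at h
    simpa [cf] using h
  set p : V → ℤ := fun v => ∑ e ∈ G, max (ε e * df ends {v} e) 0 with hp
  set q : V → ℤ := fun v => ∑ e ∈ G, max (-(ε e * df ends {v} e)) 0 with hq
  have hp0 : ∀ v, 0 ≤ p v := fun v => sum_nonneg fun e _ => le_max_right _ _
  have hq0 : ∀ v, 0 ≤ q v := fun v => sum_nonneg fun e _ => le_max_right _ _
  have hpq1 : ∀ v, p v - q v = net ends G ε {v} := by
    intro v
    simp only [hp, hq, net, ← sum_sub_distrib]
    refine sum_congr rfl fun e _ => ?_
    omega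
  have hpq2 : ∀ v, p v + q v = dc ends G {v} := by
    intro v
    simp only [hp, hq, dc, ← sum_add_distrib]
    refine sum_congr rfl fun e _ => ?_
    have : |df ends {v} e| = |ε e * df ends {v} e| := by
      rcases hε e with h | h <;> simp [h]
    rw [this]
    rcases abs_cases (ε e * df ends {v} e) with h | h <;> omega
  have hs1 : ∀ B, sm p B - sm q B = net ends G ε B := by
    intro B
    rw [net_sum, ← sm_sub]
    exact sum_congr rfl fun v _ => hpq1 v
  have hs2 : ∀ B ⊆ A, sm p B + sm q B = dc ends G B := by
    intro B hB
    rw [← sm_add]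
    have : sm (fun v => p v + q v) B = ∑ v ∈ B, dc ends G {v} := sum_congr rfl fun v _ => hpq2 v
    rw [this]
    unfold dc
    rw [sum_comm]
    refine sum_congr rfl fun e he => ?_
    have h := hout e he
    -- at most one end in B
    have key : ∀ x y : V, x ∉ B → ∑ v ∈ B, |ch {v} x - ch {v} y| = |ch B x - ch B y| := by
      intro x y hx
      have h1 : ∀ v ∈ B, |ch {v} x - ch {v} y| = ch {v} y := by
        intro v hv
        have : x ∉ ({v} : Finset V) := by rw [mem_singleton]; rintro rfl; exact hx hv
        rw [ch_not this]
        rcases ch_01 {v} y with h | h <;> simp [h]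
      rw [sum_congr rfl h1, ← ch_sum, ch_not hx]
      rcases ch_01 B y with h | h <;> simp [h]
    unfold df
    by_cases h1 : (ends e).1 ∈ B
    · have h2 : (ends e).2 ∉ B := fun h2 => h ⟨hB h1, hB h2⟩
      have := key _ (ends e).1 h2
      rw [abs_sub_comm (ch B _), ← this]
      exact sum_congr rfl fun v _ => abs_sub_comm _ _
    · exact key _ _ h1
  set γ' : V → ℤ := fun v => γ v - net ends G ε {v} with hγ'
  have hsγ : ∀ B, sm γ' B = sm γ B - net ends G ε B := by
    intro B; rw [hγ', sm_sub, net_sum ends G ε B]; rfl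
  have hcfg : Cfg k ends (F \ G) A γ' (fun v => a v + p v) (fun v => b v + q v) X := by
    refine ⟨hin, ?_, ?_, fun v => add_nonneg (a0 v) (hp0 v), fun v => add_nonneg (b0 v) (hq0 v),
      ?_, ?_, ?_⟩
    · intro v hv
      have h1 := par v (hA hv)
      have h2 := dc_net_par ends G ε hε {v}
      have h3 := dc_split (ends := ends) hGF {v}
      simp only [hγ']; omega
    · rw [hsγ]; exact htA
    · rcases hX with h | ⟨v, hv, h1, h2⟩
      · exact Or.inl h
      · refine Or.inr ⟨v, hv, h1, ?_⟩
        have := hpq1 v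
        simp only [hγ']
        rwa [show γ v - net ends G ε {v} + (a v + p v) - (b v + q v) = γ v + a v - b v by omega]
    · rw [sm_add, sm_add]
      have h1 := hs1 A
      have h2 := hs2 A (Subset.refl _)
      have h3 : dc ends F A = dc ends G A := by
        rw [dc_split hGF]
        have : dc ends (F \ G) A = 0 := sum_eq_zero fun e he => by rw [hzA e he, abs_zero]
        omega
      have h4 : nrm k (sm a A + sm p A - (sm b A + sm q A)) = nrm k (sm γ A + sm a A - sm b A) := by
        apply nrm_congr
        rw [← dvd_neg]
        rwa [show -(sm a A + sm p A - (sm b A + sm q A) - (sm γ A + sm a A - sm b A)) =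
          sm γ A - net ends G ε A by omega]
      rw [h4]; omega
    · intro B hB hne hBA hBX
      rw [sm_add, sm_add, hsγ]
      have h := low B hB hne hBA hBX
      have h1 := hs1 B
      have h2 := hs2 B hB
      have h3 := dc_split (ends := ends) hGF B
      rw [show sm γ B - net ends G ε B + (sm a B + sm p B) - (sm b B + sm q B) =
        sm γ B + sm a B - sm b B by omega]
      omega
  refine sol_partial hGF ε hε (W := A) (γ' := γ') ?_ ?_ (hLT _ _ _ _ _ _ hcfg)
  · intro v _ _; simp [hγ']
  · intro v hvU hvA
    refine ⟨?_, hzero v hvA⟩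
    have hvr : v ≠ r := fun h => hvA (h ▸ hr)
    have hmem : v ∈ insert r (U \ A) := by simp [hvU, hvA]
    have h := hs v hmem
    rw [net_pre ends F ε hr (by simpa using hmem), pre_other hvr, net_split hGF] at h
    have : net ends (F \ G) ε {v} = 0 := sum_eq_zero fun e he => by rw [hzero v hvA e he, mul_zero]
    rw [this] at h
    simpa [cf, hvr] using h

end PF

namespace PF
variable {V E : Type*} [DecidableEq V] [DecidableEq E]

def LT (E : Type*) [DecidableEq E] (k : ℤ) (U : Finset V) : Prop :=
  ∀ (ends : E → V × V) F γ a b X, Cfg k ends F U γ a b X → Sol k ends F U γ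

lemma two_le {A : Finset V} {v : V} (hv : v ∈ A) (h : A ≠ {v}) : 2 ≤ A.card := by
  by_contra hc
  have h1 : 0 < A.card := card_pos.2 ⟨v, hv⟩
  obtain ⟨w, hw⟩ := card_eq_one.1 (show A.card = 1 by omega)
  subst hw
  simp only [mem_singleton] at hv
  subst hv; exact h rfl

variable {k : ℤ} {ends : E → V × V} {F : Finset E} {U X : Finset V} {γ a b : V → ℤ}

lemma step_contract (c : Cfg k ends F U γ a b X)
    (ihU : ∀ U' : Finset V, U'.card < U.card → LT E k U') {A : Finset V} (hA : A ⊆ U) (hAU : A ≠ U)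
    (h2 : 2 ≤ A.card)
    (ht : dc ends F A + sm a A + sm b A ≤ 2 * k - 2 + nrm k (sm γ A + sm a A - sm b A)) :
    Sol k ends F U γ := by
  obtain ⟨r, hr⟩ : A.Nonempty := card_pos.1 (by omega)
  have hlt : A.card < U.card := card_lt_card (hA.ssubset_of_ne hAU)
  have hXA : ∀ B : Finset V, A ⊆ B → B ≠ X := by
    rintro B hB rfl
    have := card_le_card hB
    rcases c.hX with h | ⟨v, _, h, _⟩
    · rw [h, card_empty] at this; omega
    · rw [h, card_singleton] at this; omega
  have hU' := ccard hA hr h2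
  have hs : Sol k (cends ends A r) F (insert r (U \ A)) (cf A r γ) := by
    refine ihU _ hU' _ _ _ (cf A r a) (cf A r b) (if ∃ v ∈ A, X = {v} then ∅ else X) ?_
    refine ⟨cends_mem c.hU, cpar c.par hA hr, ?_, ?_, ?_, ?_, ?_, ?_⟩
    · rw [sm_cf γ hr (Subset.refl _), pre_full hA hr]; exact c.tot
    · intro v; unfold cf; split_ifs
      · exact sm_nonneg c.a0 _
      · exact c.a0 v
    · intro v; unfold cf; split_ifs
      · exact sm_nonneg c.b0 _
      · exact c.b0 v
    · split_ifs with h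
      · exact Or.inl rfl
      · rcases c.hX with h1 | ⟨v, hv, h1, h3⟩
        · exact Or.inl h1
        · have hvA : v ∉ A := fun hc => h ⟨v, hc, h1⟩
          have hvr : v ≠ r := fun hc => hvA (hc ▸ hr)
          exact Or.inr ⟨v, by simp [hv, hvA], h1, by simpa [cf, hvr] using h3⟩
    · rw [sm_cf a hr (Subset.refl _), sm_cf b hr (Subset.refl _), pre_full hA hr]; exact c.up
    · intro B hB hne hBU hBX
      rw [sm_cf γ hr hB, sm_cf a hr hB, sm_cf b hr hB, dc_pre ends F hr hB]
      refine c.low _ (pre_sub hA hB hr) (pre_nonempty hne) (pre_ne hA hB hr hBU) ?_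
      by_cases hrB : r ∈ B
      · apply hXA; simp [pre, hrB]
      · simp only [pre, hrB, if_false]
        split_ifs at hBX with h
        · obtain ⟨v, hv, h⟩ := h
          rintro rfl
          have := hB (show v ∈ B by simp [h])
          simp only [mem_insert, mem_sdiff] at this
          rcases this with rfl | h1
          · apply hrB; simp [h]
          · exact h1.2 hv
        · exact hBX
  refine extend (X := if ∃ v ∈ A, X = {v} then X else ∅) (ihU A hlt) c.hU c.par c.a0 c.b0 hA hr ?_ ht ?_ hs
  · split_ifs with h
    · obtain ⟨v, hv, h1⟩ := h
      rcases c.hX with h2 | ⟨w, hw, h2, h3⟩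
      · rw [h1] at h2; simp at h2
      · have : v = w := by rw [h1] at h2; simpa using h2
        subst this
        exact Or.inr ⟨v, hv, h1, h3⟩
    · exact Or.inl rfl
  · intro B hB hne hBA hBX
    refine c.low B (hB.trans hA) hne ?_ ?_
    · rintro rfl; exact hAU (Subset.antisymm hA hB)
    · split_ifs at hBX with h
      · exact hBX
      · rintro rfl
        rcases c.hX with h2 | ⟨w, hw, h2, h3⟩
        · exact hBX h2
        · exact h ⟨w, hB (by rw [h2]; simp), h2⟩

lemma Cfg.parity (hk : 0 < k) (c : Cfg k ends F U γ a b X) {A : Finset V} (hA : A ⊆ U) :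
    2 ∣ (dc ends F A + sm a A + sm b A) - nrm k (sm γ A + sm a A - sm b A) := by
  have h1 := par_set c.par hA
  have h2 := nrm_par hk (sm γ A + sm a A - sm b A)
  omega

def inc (ends : E → V × V) (F : Finset E) (v : V) : Finset E :=
  F.filter fun e => (ends e).1 = v ∨ (ends e).2 = v

lemma inc_orient (hk : 0 < k) (ends : E → V × V) (F : Finset E) (v : V) (g : ℤ)
    (h1 : nrm k g ≤ dc ends F {v})
    (h2 : 2 ∣ g - dc ends F {v}) :
    ∃ ε : E → ℤ, (∀ e, ε e = 1 ∨ ε e = -1) ∧ 2 * k ∣ g - net ends (inc ends F v) ε {v} := by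
  obtain ⟨t, ht1, ht2⟩ := nrm_rep hk g
  have hp := nrm_par hk g
  rw [← ht2] at hp h1
  have hp2 := abs_par t
  obtain ⟨ε, h3, h4⟩ := star_orient ends F v t h1 (by omega)
  refine ⟨ε, h3, ?_⟩
  have : net ends (inc ends F v) ε {v} = net ends (vstar ends F v) ε {v} := by
    symm
    apply sum_subset
    · intro e he
      unfold vstar at he; unfold inc; rw [mem_filter] at he ⊢
      refine ⟨he.1, ?_⟩
      by_contra hc
      push Not at hc
      apply he.2
      unfold df
      rw [ch_not (by simpa using hc.1), ch_not (by simpa using hc.2)]; simp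
    · intro e he hne
      simp only [vstar, inc, mem_filter, not_and, not_not] at he hne
      rw [hne he.1, mul_zero]
  rw [this, h4]; exact ht1

lemma sol_del {v : V} (ε : E → ℤ) (hε : ∀ e, ε e = 1 ∨ ε e = -1)
    (hv : 2 * k ∣ γ v - net ends (inc ends F v) ε {v})
    (h : Sol k ends (F \ inc ends F v) (U.erase v) (fun x => γ x - net ends (inc ends F v) ε {x})) :
    Sol k ends F U γ := by
  refine sol_partial (G := inc ends F v) (filter_subset _ _) ε hε (W := U.erase v) (γ' := fun x => γ x - net ends (inc ends F v) ε {x}) ?_ ?_ h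
  · intro x _ _; simp
  · intro x hx hx'
    have : x = v := by by_contra hc; exact hx' (mem_erase.2 ⟨hc, hx⟩)
    subst this
    refine ⟨hv, ?_⟩
    intro e he
    simp only [inc, mem_sdiff, mem_filter, not_and, not_or] at he
    have := he.2 he.1
    unfold df
    rw [ch_not (by simpa using this.1), ch_not (by simpa using this.2)]; simp

lemma hU_del {v : V} (hU : ∀ e ∈ F, (ends e).1 ∈ U ∧ (ends e).2 ∈ U) :
    ∀ e ∈ F \ inc ends F v, (ends e).1 ∈ U.erase v ∧ (ends e).2 ∈ U.erase v := by
  intro e he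
  simp only [inc, mem_sdiff, mem_filter, not_and, not_or] at he
  have h1 := he.2 he.1
  have h2 := hU e he.1
  simp [h1, h2]

lemma par_del {v : V} (par : ∀ v ∈ U, 2 ∣ γ v - dc ends F {v}) (ε : E → ℤ)
    (hε : ∀ e, ε e = 1 ∨ ε e = -1) :
    ∀ x ∈ U.erase v, 2 ∣ (γ x - net ends (inc ends F v) ε {x}) - dc ends (F \ inc ends F v) {x} := by
  intro x hx
  have h1 := par x (mem_of_mem_erase hx)
  have h2 := dc_net_par ends (inc ends F v) ε hε {x}
  have h3 := dc_split (ends := ends) (filter_subset (fun e => (ends e).1 = v ∨ (ends e).2 = v) F) {x}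
  unfold inc at *
  omega

lemma sm_del {v : V} (ε : E → ℤ) (A : Finset V) :
    sm (fun x => γ x - net ends (inc ends F v) ε {x}) A = sm γ A - net ends (inc ends F v) ε A := by
  rw [sm_sub, net_sum ends _ ε A]; rfl

lemma net_univ (hU : ∀ e ∈ F, (ends e).1 ∈ U ∧ (ends e).2 ∈ U) {G : Finset E} (hG : G ⊆ F)
    (ε : E → ℤ) : net ends G ε U = 0 := by
  refine sum_eq_zero fun e he => ?_
  simp [df, ch_mem (hU e (hG he)).1, ch_mem (hU e (hG he)).2]

lemma tot_del {v : V} (hv : v ∈ U) (hU : ∀ e ∈ F, (ends e).1 ∈ U ∧ (ends e).2 ∈ U)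
    (tot : 2 * k ∣ sm γ U) (ε : E → ℤ)
    (h : 2 * k ∣ γ v - net ends (inc ends F v) ε {v}) :
    2 * k ∣ sm (fun x => γ x - net ends (inc ends F v) ε {x}) (U.erase v) := by
  have h1 : sm (fun x => γ x - net ends (inc ends F v) ε {x}) U =
    (γ v - net ends (inc ends F v) ε {v}) + sm (fun x => γ x - net ends (inc ends F v) ε {x}) (U.erase v) :=
    (add_sum_erase U _ hv).symm
  rw [sm_del, net_univ hU (G := inc ends F v) (filter_subset _ _), sub_zero] at h1
  have := dvd_sub tot h
  rwa [h1, add_sub_cancel_left] at this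

lemma pendant (hk : 0 < k) (c : Cfg k ends F U γ a b X)
    (ihU : ∀ U' : Finset V, U'.card < U.card → LT E k U') {u v : V} (hv : v ∈ U) (hu : u ∈ U)
    (huv : u ≠ v) (hav : a v = 0) (hbv : b v = 0) (hXv : X = ∅ ∨ X = {v})
    (hpen : ∀ e ∈ F, (ends e).1 = v ∨ (ends e).2 = v → Joins ends e u v ∨ ends e = (v, v))
    (hn : nrm k (γ v) ≤ dc ends F {v}) : Sol k ends F U γ := by
  obtain ⟨ε, hε, h1⟩ := inc_orient hk ends F v (γ v) hn (c.par v hv)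
  refine sol_del ε hε h1 ?_
  have hcard : (U.erase v).card < U.card := card_erase_lt_of_mem hv
  refine ihU _ hcard _ _ _ a b ∅ ?_
  have hsa : ∀ f : V → ℤ, f v = 0 → sm f (U.erase v) = sm f U := by
    intro f hf
    have := add_sum_erase U f hv
    unfold sm; omega
  have hIF : inc ends F v ⊆ F := filter_subset _ _
  -- key per-edge facts
  have hdf : ∀ A : Finset V, v ∉ A → ∀ e ∈ inc ends F v, df ends A e = - (ch A u * df ends {v} e) := by
    intro A hA e he
    simp only [inc, mem_filter] at he
    rcases hpen e he.1 he.2 with (h | h) | h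
    · simp [df, h, ch, huv, hA]
    · simp [df, h, ch, huv, hA]
    · simp [df, h]
  have hdf2 : ∀ A : Finset V, u ∈ A → ∀ e ∈ inc ends F v, df ends (insert v A) e = 0 := by
    intro A hA e he
    simp only [inc, mem_filter] at he
    rcases hpen e he.1 he.2 with (h | h) | h
    · simp [df, h, ch, hA]
    · simp [df, h, ch, hA]
    · simp [df, h]
  have hdf3 : ∀ A : Finset V, ∀ e ∈ F \ inc ends F v, df ends (insert v A) e = df ends A e := by
    intro A e he
    simp only [inc, mem_sdiff, mem_filter, not_and, not_or] at he
    have h1 := he.2 he.1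
    simp [df, ch, h1]
  refine ⟨hU_del c.hU, par_del c.par ε hε, tot_del hv c.hU c.tot ε h1, c.a0, c.b0, Or.inl rfl, ?_, ?_⟩
  · rw [hsa a hav, hsa b hbv]; exact c.up
  · intro A hA hne hAU _
    have hvA : v ∉ A := fun h => by simpa using hA h
    have hAU' : A ⊆ U := hA.trans (erase_subset _ _)
    rw [sm_del]
    have hsplit := dc_split (ends := ends) hIF A
    by_cases huA : u ∈ A
    · have hB : insert v A ⊆ U := insert_subset hv hAU'
      have h5 := c.low (insert v A) hB (insert_nonempty _ _) (by
        rintro h; apply hAU; rw [← h, erase_insert hvA]) (by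
        rintro h
        have : u ∈ X := h ▸ mem_insert_of_mem huA
        rcases hXv with h | h
        · rw [h] at this; simp at this
        · rw [h] at this; exact huv (by simpa using this))
      have hin : ∀ f : V → ℤ, sm f (insert v A) = f v + sm f A := fun f => sum_insert hvA
      rw [hin, hin, hin, hav, hbv] at h5
      have h6 : dc ends F (insert v A) = dc ends (F \ inc ends F v) A := by
        rw [dc_split hIF]
        have e1 : dc ends (inc ends F v) (insert v A) = 0 :=
          sum_eq_zero fun e he => by rw [hdf2 A huA e he, abs_zero]
        have e2 : dc ends (F \ inc ends F v) (insert v A) = dc ends (F \ inc ends F v) A :=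
          sum_congr rfl fun e he => by rw [hdf3 A e he]
        omega
      have h7 : net ends (inc ends F v) ε A = - net ends (inc ends F v) ε {v} := by
        unfold net
        rw [← sum_neg_distrib]
        refine sum_congr rfl fun e he => ?_
        rw [hdf A hvA e he, ch_mem huA]; ring
      have h8 : nrm k (sm γ A - net ends (inc ends F v) ε A + sm a A - sm b A) =
          nrm k (γ v + sm γ A + (0 + sm a A) - (0 + sm b A)) := by
        apply nrm_congr
        rw [← dvd_neg, h7]
        rwa [show -(sm γ A - -net ends (inc ends F v) ε {v} + sm a A - sm b A -
          (γ v + sm γ A + (0 + sm a A) - (0 + sm b A))) = γ v - net ends (inc ends F v) ε {v} by ring]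
      rw [h8]; omega
    · have h5 := c.low A hAU' hne (fun h => hvA (h ▸ hv)) (by
        rintro rfl
        rcases hXv with h | h
        · rw [h] at hne; simp at hne
        · apply hvA; rw [h]; simp)
      have h6 : dc ends (inc ends F v) A = 0 :=
        sum_eq_zero fun e he => by rw [hdf A hvA e he, ch_not huA]; simp
      have h7 : net ends (inc ends F v) ε A = 0 :=
        sum_eq_zero fun e he => by rw [hdf A hvA e he, ch_not huA]; simp
      rw [h7, sub_zero]; omega

end PF

namespace PF
variable {V E : Type*} [DecidableEq V] [DecidableEq E]
variable {k : ℤ} {ends : E → V × V} {F : Finset E} {U X : Finset V} {γ a b : V → ℤ}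

def Slack (k : ℤ) (ends : E → V × V) (F : Finset E) (U : Finset V) (γ a b : V → ℤ) : Prop :=
  ∀ A ⊆ U, A ≠ U → 2 ≤ A.card →
    2 * k + nrm k (sm γ A + sm a A - sm b A) ≤ dc ends F A + sm a A + sm b A

lemma sm_shift (f : V → ℤ) (x y : V) (A : Finset V) :
    sm (fun v => f v + (pt y v - pt x v)) A = sm f A + (ch A y - ch A x) := by
  rw [sm_add, sm_sub]
  have h1 := sm_pt A x
  have h2 := sm_pt A y
  unfold sm at *
  omega

lemma net_neg (ends : E → V × V) (F : Finset E) (ε : E → ℤ) (A : Finset V) :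
    net ends F (fun e => - ε e) A = - net ends F ε A := by
  unfold net; rw [← sum_neg_distrib]; exact sum_congr rfl fun e _ => by ring

lemma sol_neg (h : Sol k ends F U (fun v => - γ v)) : Sol k ends F U γ := by
  obtain ⟨ε, h1, h2⟩ := h
  refine ⟨fun e => - ε e, fun e => ?_, fun v hv => ?_⟩
  · rcases h1 e with h | h <;> simp [h]
  · rw [net_neg, ← dvd_neg]
    have := h2 v hv
    rwa [show -(γ v - - net ends F ε {v}) = - γ v - net ends F ε {v} by ring]

lemma nrm_flip (hk : 0 < k) (x y z : ℤ) : nrm k (-x + y - z) = nrm k (x + z - y) := by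
  rw [← nrm_neg hk]; congr 1; ring

lemma Cfg.neg (hk : 0 < k) (c : Cfg k ends F U γ a b X) :
    Cfg k ends F U (fun v => - γ v) b a X := by
  refine ⟨c.hU, fun v hv => ?_, ?_, c.b0, c.a0, ?_, ?_, ?_⟩
  · have := c.par v hv; omega
  · rw [sm_neg, dvd_neg]; exact c.tot
  · rcases c.hX with h | ⟨v, hv, h, h1⟩
    · exact Or.inl h
    · refine Or.inr ⟨v, hv, h, ?_⟩
      rw [← dvd_neg]
      rwa [show -(- γ v + b v - a v) = γ v + a v - b v by ring]
  · have := c.up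
    rw [show sm b U - sm a U = -(sm a U - sm b U) by ring, nrm_neg hk]; omega
  · intro A h1 h2 h3 h4
    have := c.low A h1 h2 h3 h4
    rw [sm_neg, nrm_flip hk]; omega

lemma Slack.neg (hk : 0 < k) (c : Slack k ends F U γ a b) :
    Slack k ends F U (fun v => - γ v) b a := by
  intro A h1 h2 h3
  have := c A h1 h2 h3
  rw [sm_neg, nrm_flip hk]; omega

lemma card_cases {A : Finset V} (h : A.Nonempty) : (∃ x, A = {x}) ∨ 2 ≤ A.card := by
  obtain ⟨x, hx⟩ := h
  by_cases h : A = {x}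
  · exact Or.inl ⟨x, h⟩
  · exact Or.inr (two_le hx h)

/-- shifting a unit of `a` from `v` along an edge `u v` -/
lemma step_a (c : Cfg k ends F U γ a b {t}) (hs : Slack k ends F U γ a b)
    (ihF : ∀ (ends : E → V × V) F' γ a b X, F'.card < F.card → Cfg k ends F' U γ a b X →
      Sol k ends F' U γ)
    {e : E} {u v : V} (htv : t = v) (he : e ∈ F) (hj : Joins ends e u v) (huv : u ≠ v)
    (hav : 0 < a v) : Sol k ends F U γ := by
  subst htv
  have hm := joins_mem c.hU he hj
  refine sol_edge he hj (ihF _ _ _ (fun x => a x + (pt u x - pt t x)) b {t}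
    (card_erase_lt_of_mem he) ?_)
  have hsing : ∀ x y : V, ch {x} y = pt y x := by
    intro x y; simp [ch, pt, eq_comm]
  refine ⟨fun e he => c.hU e (mem_of_mem_erase he), ?_, ?_, ?_, c.b0, ?_, ?_, ?_⟩
  · intro x hx
    have h1 := c.par x hx
    rw [dc_erase he hj, hsing, hsing]
    have := abs_par (pt u x - pt t x)
    omega
  · rw [sm_shift, ch_mem hm.1, ch_mem hm.2]; simpa using c.tot
  · intro x
    have h1 := c.a0 x
    have h2 := pt_nonneg u x
    by_cases hx : x = t
    · subst hx; rw [pt_self]; omega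
    · rw [pt_ne hx]; omega
  · rcases c.hX with h | ⟨w, hw, h, h1⟩
    · simp at h
    · have : t = w := by simpa using h
      subst this
      refine Or.inr ⟨t, hw, rfl, ?_⟩
      convert h1 using 1; ring
  · rw [sm_shift, ch_mem hm.1, ch_mem hm.2]; simpa using c.up
  · intro A hA hne hAU hAX
    rw [sm_shift, sm_shift, dc_erase he hj]
    have hh : sm γ A + (ch A t - ch A u) + (sm a A + (ch A u - ch A t)) - sm b A =
      sm γ A + sm a A - sm b A := by ring
    rw [hh]
    rcases card_cases hne with ⟨x, rfl⟩ | h2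
    · have := c.low _ hA hne hAU hAX
      have hxt : ¬ t ∈ ({x} : Finset V) := by
        simp only [mem_singleton]; rintro rfl; exact hAX rfl
      rw [ch_not hxt]
      rcases ch_01 {x} u with h | h <;> rw [h] <;> norm_num <;> omega
    · have := hs A hA hAU h2
      rcases ch_01 A u with h | h <;> rcases ch_01 A t with h' | h' <;> rw [h, h'] <;>
        norm_num <;> omega

lemma step_lift (c : Cfg k ends F U γ a b {v}) (hs : Slack k ends F U γ a b)
    (ihF : ∀ (ends : E → V × V) F' γ a b X, F'.card < F.card → Cfg k ends F' U γ a b X →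
      Sol k ends F' U γ)
    {e f : E} {u w : V} (he : e ∈ F) (hf : f ∈ F) (hef : e ≠ f) (h1 : Joins ends e u v)
    (h2 : Joins ends f v w) (huw : u ≠ w) : Sol k ends F U γ := by
  refine sol_lift he hf hef h1 h2 (ihF _ _ _ a b {v} (card_erase_lt_of_mem hf) ?_)
  refine ⟨ends_lift c.hU he hf h1 h2, ?_, c.tot, c.a0, c.b0, c.hX, c.up, ?_⟩
  · intro x hx
    have h := c.par x hx
    rw [dc_lift he hf hef h1 h2]
    have p1 := abs_par (ch {x} u - ch {x} v)
    have p2 := abs_par (ch {x} v - ch {x} w)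
    have p3 := abs_par (ch {x} u - ch {x} w)
    omega
  · intro A hA hne hAU hAX
    rw [dc_lift he hf hef h1 h2]
    rcases card_cases hne with ⟨x, rfl⟩ | h3
    · have := c.low _ hA hne hAU hAX
      have hxt : ¬ v ∈ ({x} : Finset V) := by
        simp only [mem_singleton]; rintro rfl; exact hAX rfl
      rw [ch_not hxt]
      have : ¬ (ch {x} u = 1 ∧ ch {x} w = 1) := by
        rintro ⟨h4, h5⟩
        have h6 : u ∈ ({x} : Finset V) := by
          by_contra hc; rw [ch_not hc] at h4; omega
        have h7 : w ∈ ({x} : Finset V) := by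
          by_contra hc; rw [ch_not hc] at h5; omega
        rw [mem_singleton] at h6 h7
        exact huw (h6.trans h7.symm)
      have : |ch {x} u - 0| + |0 - ch {x} w| = |ch {x} u - ch {x} w| := by
        rcases ch_01 {x} u with h | h <;> rcases ch_01 {x} w with h' | h'
        · rw [h, h']; norm_num
        · rw [h, h']; norm_num
        · rw [h, h']; norm_num
        · exact absurd ⟨h, h'⟩ this
      omega
    · have := hs A hA hAU h3
      rcases ch_01 A u with h | h <;> rcases ch_01 A v with h' | h' <;>
        rcases ch_01 A w with h'' | h'' <;> rw [h, h', h''] <;> norm_num <;> omega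

lemma step_v (hk : 0 < k) (c : Cfg k ends F U γ a b {v}) (hs : Slack k ends F U γ a b)
    (ihU : ∀ U' : Finset V, U'.card < U.card → LT E k U')
    (ihF : ∀ (ends : E → V × V) F' γ a b X, F'.card < F.card → Cfg k ends F' U γ a b X →
      Sol k ends F' U γ) (h2 : 2 ≤ U.card) : Sol k ends F U γ := by
  have hv : v ∈ U ∧ 2 * k ∣ γ v + a v - b v := by
    rcases c.hX with h | ⟨w, hw, h, h1⟩
    · simp at h
    · have : v = w := by simpa using h
      subst this; exact ⟨hw, h1⟩
  obtain ⟨hvU, hd⟩ := hv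
  by_cases hdc : dc ends F {v} = 0
  · -- isolated
    obtain ⟨u, hu, huv⟩ : ∃ u ∈ U, u ≠ v := exists_mem_ne (by omega) v
    have hlow := c.low (U \ {v}) sdiff_subset ⟨u, by simp [hu, huv]⟩ (by
      intro h; have : v ∈ U \ {v} := by rw [h]; exact hvU
      simp at this) (by
      intro h; have : v ∈ U \ {v} := by rw [h]; simp
      simp at this)
    have hsub : ({v} : Finset V) ⊆ U := by simpa using hvU
    rw [dc_compl c.hU, hdc, sm_sdiff _ hsub, sm_sdiff _ hsub, sm_sdiff _ hsub, sm_single, sm_single,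
      sm_single] at hlow
    have hn : nrm k (sm γ U - γ v + (sm a U - a v) - (sm b U - b v)) = nrm k (sm a U - sm b U) := by
      apply nrm_congr
      have := dvd_sub c.tot hd
      rwa [show sm γ U - γ v + (sm a U - a v) - (sm b U - b v) - (sm a U - sm b U) =
        sm γ U - (γ v + a v - b v) by ring]
    rw [hn] at hlow
    have hup := c.up
    have ha := c.a0 v
    have hb := c.b0 v
    have ha0 : a v = 0 := by omega
    have hb0 : b v = 0 := by omega
    refine pendant hk c ihU hvU hu huv ha0 hb0 (Or.inr rfl) ?_ ?_
    · intro e he h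
      right
      by_contra hne
      have : ∃ w, w ≠ v ∧ Joins ends e v w := by
        rcases h with h | h
        · exact ⟨(ends e).2, fun h' => hne (Prod.ext h h'), Or.inl (Prod.ext h rfl)⟩
        · exact ⟨(ends e).1, fun h' => hne (Prod.ext h' h), Or.inr (Prod.ext rfl h)⟩
      obtain ⟨w, hw, hj⟩ := this
      have := cross_pos (A := {v}) he hj (by simp) (by simpa using hw)
      omega
    · rw [hdc, nrm_dvd hk]
      simpa [ha0, hb0] using hd
  · obtain ⟨e, he, v', u, hj, hv', hu⟩ := exists_cross hdc
    have : v' = v := by simpa using hv'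
    subst this
    have huv : u ≠ v' := by simpa using hu
    have hj' := joins_symm hj
    by_cases ha : 0 < a v'
    · exact step_a c hs ihF rfl he hj' huv ha
    by_cases hb : 0 < b v'
    · exact sol_neg (step_a (c.neg hk) (hs.neg hk) ihF rfl he hj' huv hb)
    have ha0 : a v' = 0 := le_antisymm (not_lt.1 ha) (c.a0 _)
    have hb0 : b v' = 0 := le_antisymm (not_lt.1 hb) (c.b0 _)
    by_cases hf : ∃ f ∈ F, ∃ w, Joins ends f v' w ∧ w ≠ v' ∧ w ≠ u
    · obtain ⟨f, hf, w, h3, h4, h5⟩ := hf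
      refine step_lift c hs ihF he hf ?_ hj' h3 h5.symm
      rintro rfl
      rcases hj with h | h <;> rcases h3 with h6 | h6 <;> rw [h] at h6 <;> simp at h6
      · exact h5 h6.symm
      · exact huv h6.2
      · exact huv h6.1
      · exact h5 h6.symm
    · push Not at hf
      refine pendant hk c ihU hvU (joins_mem c.hU he hj).2 huv ha0 hb0 (Or.inr rfl) ?_ ?_
      · intro f hfF h
        rcases h with h | h
        · by_cases h5 : (ends f).2 = v'
          · right; exact Prod.ext h h5
          · have := hf f hfF (ends f).2 (Or.inl (Prod.ext h rfl)) h5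
            left; right; exact Prod.ext h this
        · by_cases h5 : (ends f).1 = v'
          · right; exact Prod.ext h5 h
          · have := hf f hfF (ends f).1 (Or.inr (Prod.ext rfl h)) h5
            left; left; exact Prod.ext this h
      · rw [nrm_dvd hk (by simpa [ha0, hb0] using hd)]; exact dc_nonneg _ _ _
end PF

namespace PF
variable {V E : Type*} [DecidableEq V] [DecidableEq E]
variable {k : ℤ} {ends : E → V × V} {F : Finset E} {U X : Finset V} {γ a b : V → ℤ}

lemma ch_sing (x y : V) : ch {x} y = pt y x := by
  simp [ch, pt, eq_comm]

lemma sm_addpt (f : V → ℤ) (c : ℤ) (y : V) (A : Finset V) :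
    sm (fun v => f v + c * pt y v) A = sm f A + c * ch A y := by
  rw [sm_add, sm_mul]
  have h1 := sm_pt A y
  rw [← h1]

lemma orient_gen (hk : 0 < k) (c : Cfg k ends F U γ a b ∅) (hs : Slack k ends F U γ a b)
    (ihF : ∀ (ends : E → V × V) F' γ a b X, F'.card < F.card → Cfg k ends F' U γ a b X →
      Sol k ends F' U γ)
    {e : E} {x y : V} (he : e ∈ F) (hj : Joins ends e x y) (hxy : x ≠ y)
    (p q : ℤ) (hp : 0 ≤ p) (hq : 0 ≤ q)
    (hx : nrm k (γ x + a x - b x - 1) ≤ nrm k (γ x + a x - b x) - 1)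
    (hy : 2 * k - 2 + nrm k (γ y + a y - b y + 1 + p - q) ≤ dc ends F {y} + a y + b y - 1 + p + q)
    (hup : sm a U + sm b U + p + q ≤ 2 * k - 2 + nrm k (sm a U - sm b U + p - q)) :
    Sol k ends F U γ := by
  have hm := joins_mem c.hU he hj
  refine sol_edge he hj (ihF _ _ _ (fun v => a v + p * pt y v) (fun v => b v + q * pt y v) ∅
    (card_erase_lt_of_mem he) ?_)
  refine ⟨fun e he => c.hU e (mem_of_mem_erase he), ?_, ?_, ?_, ?_, Or.inl rfl, ?_, ?_⟩
  · intro v hv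
    have h1 := c.par v hv
    rw [dc_erase he hj, ch_sing, ch_sing]
    have := abs_par (pt x v - pt y v)
    omega
  · rw [sm_shift, ch_mem hm.1, ch_mem hm.2]; simpa using c.tot
  · intro v; exact add_nonneg (c.a0 v) (mul_nonneg hp (pt_nonneg _ _))
  · intro v; exact add_nonneg (c.b0 v) (mul_nonneg hq (pt_nonneg _ _))
  · rw [sm_addpt, sm_addpt, ch_mem hm.2]
    rw [show sm a U + p * 1 - (sm b U + q * 1) = sm a U - sm b U + p - q by ring]
    linarith
  · intro A hA hne hAU hAX
    rw [sm_addpt, sm_addpt, sm_shift, dc_erase he hj]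
    rw [show sm γ A + (ch A y - ch A x) + (sm a A + p * ch A y) - (sm b A + q * ch A y) =
      (sm γ A + sm a A - sm b A) + (ch A y - ch A x + (p - q) * ch A y) by ring]
    rcases card_cases hne with ⟨v, rfl⟩ | h2
    · have hl := c.low _ hA hne hAU hAX
      by_cases hvy : v = y
      · subst hvy
        have h1 : ch {v} v = 1 := ch_mem (by simp)
        have h3 : ch {v} x = 0 := ch_not (by simpa using hxy)
        rw [h1, h3, sm_single, sm_single, sm_single,
          show γ v + a v - b v + (1 - 0 + (p - q) * 1) = γ v + a v - b v + 1 + p - q by ring]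
        norm_num
        linarith
      have h1 : ch {v} y = 0 := ch_not (by simpa using Ne.symm hvy)
      by_cases hvx : v = x
      · subst hvx
        have h3 : ch {v} v = 1 := ch_mem (by simp)
        rw [sm_single, sm_single, sm_single] at hl
        rw [h1, h3, sm_single, sm_single, sm_single,
          show γ v + a v - b v + (0 - 1 + (p - q) * 0) = γ v + a v - b v - 1 by ring]
        norm_num
        linarith
      have h3 : ch {v} x = 0 := ch_not (by simpa using Ne.symm hvx)
      rw [h1, h3]; norm_num; linarith
    · have hl := hs A hA hAU h2
      have h3 := nrm_add_abs hk (sm γ A + sm a A - sm b A) (ch A y - ch A x + (p - q) * ch A y)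
      have h4 : |ch A y - ch A x + (p - q) * ch A y| + |ch A x - ch A y| ≤
          2 + p * ch A y + q * ch A y := by
        rcases ch_01 A x with h | h <;> rcases ch_01 A y with h' | h' <;> rw [h, h']
        · norm_num
        · have : |1 - 0 + (p - q) * 1| ≤ 1 + p + q := abs_le.2 ⟨by linarith, by linarith⟩
          norm_num at this ⊢; linarith
        · norm_num
        · have : |1 - 1 + (p - q) * 1| ≤ p + q := abs_le.2 ⟨by linarith, by linarith⟩
          norm_num at this ⊢; linarith
      linarith

lemma conn (hk : 2 ≤ k) (c : Cfg k ends F U γ a b ∅) {A : Finset V} (hA : A ⊆ U) (hne : A.Nonempty)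
    (hAU : A ≠ U) : dc ends F A ≠ 0 := by
  intro h
  have hk0 : 0 < k := by omega
  have hB : (U \ A).Nonempty := by
    rw [sdiff_nonempty]; exact fun h => hAU (Subset.antisymm hA h)
  have hB' : U \ A ≠ U := by
    intro h
    obtain ⟨x, hx⟩ := hne
    have := hA hx
    rw [← h] at this
    exact (mem_sdiff.1 this).2 hx
  have h1 := c.low A hA hne hAU (nonempty_iff_ne_empty.1 hne)
  have h2 := c.low (U \ A) sdiff_subset hB hB' (nonempty_iff_ne_empty.1 hB)
  rw [dc_compl c.hU, h, sm_sdiff _ hA, sm_sdiff _ hA, sm_sdiff _ hA] at h2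
  have h3 := nrm_add hk0 (sm γ A + sm a A - sm b A) (sm γ U - sm γ A + (sm a U - sm a A) - (sm b U - sm b A))
  have h4 : nrm k (sm γ A + sm a A - sm b A + (sm γ U - sm γ A + (sm a U - sm a A) - (sm b U - sm b A))) =
    nrm k (sm a U - sm b U) := by
    apply nrm_congr
    have := c.tot
    rwa [show sm γ A + sm a A - sm b A + (sm γ U - sm γ A + (sm a U - sm a A) - (sm b U - sm b A)) -
      (sm a U - sm b U) = sm γ U by ring]
  have := c.up
  omega

lemma nrm_t {τ t : ℤ} (h : 2 * k ∣ τ - t) (d : ℤ) : nrm k (τ + d) = nrm k (t + d) :=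
  nrm_congr (by rwa [show τ + d - (t + d) = τ - t by ring])

lemma nrm_big (h1 : k ≤ x) (h2 : x ≤ 2 * k) (hk : 0 < k) : nrm k x = 2 * k - x := by
  have : nrm k x = nrm k (x - 2 * k) := nrm_congr ⟨1, by ring⟩
  rw [this, ← nrm_neg hk, nrm_small hk] <;> omega

lemma single_ne (h2 : 2 ≤ U.card) (v : V) : ({v} : Finset V) ≠ U := by
  rintro rfl; simp at h2

lemma exists_edge (hk : 2 ≤ k) (c : Cfg k ends F U γ a b ∅) (h2 : 2 ≤ U.card) {v : V} (hv : v ∈ U) :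
    ∃ e ∈ F, ∃ y ∈ U, Joins ends e v y ∧ y ≠ v := by
  have := conn hk c (A := {v}) (by simpa using hv) (by simp) (single_ne h2 v)
  obtain ⟨e, he, x, y, hj, hx, hy⟩ := exists_cross this
  have : x = v := by simpa using hx
  subst this
  exact ⟨e, he, y, (joins_mem c.hU he hj).2, hj, by simpa using hy⟩

lemma low1 (c : Cfg k ends F U γ a b ∅) (h2 : 2 ≤ U.card) {v : V} (hv : v ∈ U) :
    2 * k - 2 + nrm k (γ v + a v - b v) ≤ dc ends F {v} + a v + b v := by
  have := c.low {v} (by simpa using hv) (by simp) (single_ne h2 v) (by simp)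
  simpa [sm_single] using this

lemma step_pos (hk : 2 ≤ k) (c : Cfg k ends F U γ a b ∅) (hs : Slack k ends F U γ a b)
    (ihF : ∀ (ends : E → V × V) F' γ a b X, F'.card < F.card → Cfg k ends F' U γ a b X →
      Sol k ends F' U γ)
    (ihW : ∀ a' b' : V → ℤ, sm a' U + sm b' U < sm a U + sm b U → Cfg k ends F U γ a' b' ∅ →
      Sol k ends F U γ)
    (h2 : 2 ≤ U.card) (t : V → ℤ) (ht : ∀ v ∈ U, 2 * k ∣ γ v + a v - b v - t v)
    (ht0 : ∀ v ∈ U, 0 < t v) (htk : ∀ v ∈ U, t v ≤ k) : Sol k ends F U γ := by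
  have hk0 : 0 < k := by omega
  have hn : ∀ v ∈ U, nrm k (γ v + a v - b v) = t v := fun v hv => by
    have := nrm_t (ht v hv) 0
    rw [add_zero, add_zero] at this
    rw [this, nrm_small hk0 (ht0 v hv).le (htk v hv)]
  have hx : ∀ x ∈ U, nrm k (γ x + a x - b x - 1) = nrm k (γ x + a x - b x) - 1 := by
    intro x hx
    have h0 := ht0 x hx
    have hkk := htk x hx
    have := nrm_t (ht x hx) (-1)
    rw [hn x hx, sub_eq_add_neg, this, nrm_small hk0 (by omega) (by omega)]; ring
  by_cases h1 : ∃ v ∈ U, t v = k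
  · obtain ⟨v, hv, hvk⟩ := h1
    obtain ⟨e, he, y, hy, hj, hyv⟩ := exists_edge hk c h2 hv
    refine orient_gen hk0 c hs ihF he (joins_symm hj) hyv 0 0 le_rfl le_rfl (hx y hy).le ?_ ?_
    · have h3 := low1 c h2 hv
      have h4 := nrm_t (ht v hv) 1
      rw [hvk, nrm_big (x := k + 1) (by omega) (by omega) hk0] at h4
      rw [hn v hv, hvk] at h3
      simp only [add_zero, sub_zero]
      omega
    · simpa using c.up
  push Not at h1
  by_cases h3 : ∃ v ∈ U, 0 < a v
  · obtain ⟨v, hv, hav⟩ := h3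
    have hsv : ∀ A, sm (fun u => a u + (-1) * pt v u) A = sm a A + (-1) * ch A v := sm_addpt a (-1) v
    refine ihW (fun u => a u + (-1) * pt v u) b ?_ ?_
    · rw [hsv, ch_mem hv]; omega
    · refine ⟨c.hU, c.par, c.tot, ?_, c.b0, Or.inl rfl, ?_, ?_⟩
      · intro u
        have := c.a0 u
        by_cases huv : u = v
        · subst huv; rw [pt_self]; omega
        · rw [pt_ne huv]; omega
      · rw [hsv, ch_mem hv]
        have h4 := nrm_add_abs hk0 (sm a U + -1 * 1 - sm b U) 1
        rw [show sm a U + -1 * 1 - sm b U + 1 = sm a U - sm b U by ring, abs_one] at h4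
        have := c.up
        omega
      · intro A hA hne hAU hAX
        rw [hsv]
        by_cases hvA : v ∈ A
        · rw [ch_mem hvA]
          rcases card_cases hne with ⟨u, rfl⟩ | h5
          · have : v = u := by simpa using hvA
            subst this
            have h6 := low1 c h2 hv
            have h7 := hx v hv
            rw [sm_single, sm_single, sm_single,
              show γ v + (a v + -1 * 1) - b v = γ v + a v - b v - 1 by ring]
            omega
          · have h6 := hs A hA hAU h5
            have h4 := nrm_add_abs hk0 (sm γ A + sm a A - sm b A) (-1)
            rw [show sm γ A + (sm a A + -1 * 1) - sm b A = sm γ A + sm a A - sm b A + -1 by ring]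
            rw [abs_neg, abs_one] at h4
            omega
        · rw [ch_not hvA]
          have := c.low A hA hne hAU hAX
          simpa using this
  push Not at h3
  have ha0 : sm a U = 0 := sum_eq_zero fun v hv => le_antisymm (h3 v hv) (c.a0 v)
  obtain ⟨x, hxU⟩ : U.Nonempty := card_pos.1 (by omega)
  obtain ⟨e, he, y, hyU, hj, hyx⟩ := exists_edge hk c h2 hxU
  by_cases hW : sm b U + 1 ≤ 2 * k - 2 + nrm k (sm b U + 1)
  · refine orient_gen hk0 c hs ihF he hj hyx.symm 0 1 le_rfl (by norm_num) (hx x hxU).le ?_ ?_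
    · have := low1 c h2 hyU
      rw [show γ y + a y - b y + 1 + 0 - 1 = γ y + a y - b y by ring]
      omega
    · rw [ha0, show (0 : ℤ) - sm b U + 0 - 1 = -(sm b U + 1) by ring, nrm_neg hk0]
      omega
  · have hup := c.up
    rw [ha0, zero_sub, nrm_neg hk0] at hup
    have hW1 : sm b U = 2 * k - 1 := by
      have p1 := nrm_par hk0 (sm b U + 1)
      have p2 := nrm_add_abs hk0 (sm b U + 1) (-1)
      rw [abs_neg, abs_one, add_neg_cancel_right] at p2
      have p3 := nrm_le_k (k := k) (sm b U)
      have p4 := nrm_nonneg hk0 (sm b U + 1)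
      by_contra hc
      have hb : 2 * k ≤ sm b U := by omega
      have p5 : nrm k (sm b U) = nrm k (sm b U - 2 * k) := nrm_congr ⟨1, by ring⟩
      rw [nrm_small (x := sm b U - 2 * k) hk0 (by omega) (by omega)] at p5
      omega
    have h0 := ht0 x hxU
    have hkk := htk x hxU
    refine orient_gen hk0 c hs ihF he (joins_symm hj) hyx (k - t x) 0 (by omega) le_rfl (hx y hyU).le ?_ ?_
    · have h5 := low1 c h2 hxU
      rw [hn x hxU] at h5
      have h4 := nrm_t (ht x hxU) (1 + (k - t x))
      rw [nrm_big (x := t x + (1 + (k - t x))) (by omega) (by omega) hk0] at h4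
      rw [show γ x + a x - b x + 1 + (k - t x) - 0 = γ x + a x - b x + (1 + (k - t x)) by ring]
      omega
    · rw [ha0, hW1]
      have : nrm k (0 - (2 * k - 1) + (k - t x) - 0) = nrm k (1 + k - t x) :=
        nrm_congr ⟨-1, by ring⟩
      rw [this, nrm_small hk0 (by omega) (by omega)]
      omega

lemma step_main (hk : 2 ≤ k) (c : Cfg k ends F U γ a b ∅) (hs : Slack k ends F U γ a b)
    (ihF : ∀ (ends : E → V × V) F' γ a b X, F'.card < F.card → Cfg k ends F' U γ a b X →
      Sol k ends F' U γ)
    (ihW : ∀ γ a' b' : V → ℤ, sm a' U + sm b' U < sm a U + sm b U → Cfg k ends F U γ a' b' ∅ →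
      Sol k ends F U γ)
    (h2 : 2 ≤ U.card) (hno : ∀ v ∈ U, ¬ 2 * k ∣ γ v + a v - b v) : Sol k ends F U γ := by
  have hk0 : 0 < k := by omega
  choose t ht1 ht2 using fun v => nrm_rep hk0 (γ v + a v - b v)
  have ht0 : ∀ v ∈ U, t v ≠ 0 := by
    intro v hv h
    have := ht1 v
    rw [h, sub_zero] at this
    exact hno v hv this
  have htk : ∀ v, |t v| ≤ k := fun v => by rw [ht2]; exact nrm_le_k _
  by_cases hpos : ∀ v ∈ U, 0 < t v
  · exact step_pos hk c hs ihF (ihW γ) h2 t (fun v _ => ht1 v) hpos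
      (fun v hv => (le_abs_self _).trans (htk v))
  by_cases hneg : ∀ v ∈ U, t v < 0
  · apply sol_neg
    refine step_pos hk (c.neg hk0) (hs.neg hk0) ihF (fun a' b' h => ihW _ a' b' (by omega)) h2 (fun v => - t v) (fun v _ => ?_)
      (fun v hv => by have := hneg v hv; omega) (fun v hv => (neg_le_abs _).trans (htk v))
    have := ht1 v
    rw [← dvd_neg]
    rwa [show -(-γ v + b v - a v - -t v) = γ v + a v - b v - t v by ring]
  push Not at hpos hneg
  obtain ⟨y0, hy0, hy0'⟩ := hpos
  obtain ⟨x0, hx0, hx0'⟩ := hneg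
  have hc := conn hk c (A := U.filter fun v => 0 < t v) (filter_subset _ _)
    ⟨x0, by have := ht0 x0 hx0; simp only [mem_filter]; exact ⟨hx0, by omega⟩⟩ (by
    intro h
    rw [← h] at hy0
    have := (mem_filter.1 hy0).2
    omega)
  obtain ⟨e, he, x, y, hj, hx, hy⟩ := exists_cross hc
  have hm := joins_mem c.hU he hj
  have hxt := (mem_filter.1 hx).2
  have hyt : t y < 0 := by
    have h1 := ht0 y hm.2
    by_contra hc
    exact hy (mem_filter.2 ⟨hm.2, by omega⟩)
  have hxk := htk x
  have hyk := htk y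
  have hx2 := ht2 x
  have hy2 := ht2 y
  rw [abs_of_pos hxt] at hxk hx2
  rw [abs_of_neg hyt] at hyk hy2
  refine orient_gen hk0 c hs ihF he hj (by rintro rfl; exact hy hx) 0 0 le_rfl le_rfl ?_ ?_ ?_
  · have := nrm_t (ht1 x) (-1)
    rw [sub_eq_add_neg _ (1 : ℤ), this, nrm_small hk0 (by omega) (by omega)]
    omega
  · have h3 := low1 c h2 hm.2
    have h4 := nrm_t (ht1 y) 1
    rw [← nrm_neg hk0 (t y + 1), nrm_small (x := -(t y + 1)) hk0 (by omega) (by omega)] at h4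
    simp only [add_zero, sub_zero]
    omega
  · simpa using c.up

lemma LT_small (c : Cfg k ends F U γ a b X) (h : U.card ≤ 1) : Sol k ends F U γ := by
  refine ⟨fun _ => 1, fun _ => Or.inl rfl, fun v hv => ?_⟩
  have hUv : U = {v} := by
    by_contra hc
    have := two_le hv hc
    omega
  have h1 : net ends F (fun _ => 1) {v} = 0 := by
    rw [← hUv]; exact net_univ c.hU (Subset.refl _) _
  have := c.tot
  rw [hUv, sm_single] at this
  rwa [h1, sub_zero]

lemma LT_all (hk : 2 ≤ k) (U : Finset V) : LT E k U := by
  have hk0 : 0 < k := by omega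
  generalize hn : U.card = n
  induction n using Nat.strong_induction_on generalizing U with
  | _ n ihn =>
  have ihU : ∀ U' : Finset V, U'.card < U.card → LT E k U' := fun U' h => ihn _ (hn ▸ h) U' rfl
  intro ends F γ a b X c
  generalize hm : F.card = m
  induction m using Nat.strong_induction_on generalizing ends F γ a b X with
  | _ m ihm =>
  have ihF : ∀ (ends : E → V × V) F' γ a b X, F'.card < F.card → Cfg k ends F' U γ a b X →
      Sol k ends F' U γ := fun ends F' γ a b X h c => ihm _ (hm ▸ h) ends F' γ a b X c rfl
  clear ihm ihn
  generalize hw : (sm a U + sm b U).toNat = w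
  induction w using Nat.strong_induction_on generalizing γ a b X with
  | _ w ihw =>
  have ihW : ∀ γ a' b' : V → ℤ, sm a' U + sm b' U < sm a U + sm b U → Cfg k ends F U γ a' b' ∅ →
      Sol k ends F U γ := by
    intro γ a' b' h c'
    have h1 := sm_nonneg c'.a0 U
    have h2 := sm_nonneg c'.b0 U
    exact ihw _ (by omega) γ a' b' ∅ c' rfl
  by_cases hc : U.card ≤ 1
  · exact LT_small c hc
  by_cases hA : ∃ A, A ⊆ U ∧ A ≠ U ∧ 2 ≤ A.card ∧ dc ends F A + sm a A + sm b A ≤ 2 * k - 2 + nrm k (sm γ A + sm a A - sm b A)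
  · obtain ⟨A, h1, h2, h3, h4⟩ := hA
    exact step_contract c ihU h1 h2 h3 h4
  push Not at hA
  have hs : Slack k ends F U γ a b := by
    intro A h1 h2 h3
    have h4 := hA A h1 h2 h3
    have h5 := c.parity hk0 h1
    omega
  by_cases hX : X = ∅
  · subst hX
    by_cases hz : ∃ v ∈ U, 2 * k ∣ γ v + a v - b v
    · obtain ⟨v, hv, hd⟩ := hz
      have c' : Cfg k ends F U γ a b {v} :=
        ⟨c.hU, c.par, c.tot, c.a0, c.b0, Or.inr ⟨v, hv, rfl, hd⟩, c.up,
          fun A h1 h2 h3 _ => c.low A h1 h2 h3 (nonempty_iff_ne_empty.1 h2)⟩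
      exact step_v hk0 c' hs ihU ihF (by omega)
    · push Not at hz
      exact step_main hk c hs ihF ihW (by omega) hz
  · obtain ⟨v, hv, rfl⟩ : ∃ v ∈ U, X = {v} := by
      rcases c.hX with h | ⟨v, hv, h, _⟩
      · exact absurd h hX
      · exact ⟨v, hv, h⟩
    exact step_v hk0 c hs ihU ihF (by omega)
end PF

namespace PF
variable {V E : Type*} [DecidableEq V] [DecidableEq E]
variable {k : ℤ} {ends : E → V × V} {F : Finset E} {U X : Finset V} {γ a b : V → ℤ}

lemma pen1 {u v : V} (huv : u ≠ v)
    (hpen : ∀ e ∈ F, (ends e).1 = v ∨ (ends e).2 = v → Joins ends e u v ∨ ends e = (v, v)) :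
    ∀ A : Finset V, v ∉ A → ∀ e ∈ inc ends F v, df ends A e = - (ch A u * df ends {v} e) := by
  intro A hA e he
  simp only [inc, mem_filter] at he
  rcases hpen e he.1 he.2 with (h | h) | h
  · simp [df, h, ch, huv, hA]
  · simp [df, h, ch, huv, hA]
  · simp [df, h]

lemma pen2 {u v : V}
    (hpen : ∀ e ∈ F, (ends e).1 = v ∨ (ends e).2 = v → Joins ends e u v ∨ ends e = (v, v)) :
    ∀ A : Finset V, u ∈ A → ∀ e ∈ inc ends F v, df ends (insert v A) e = 0 := by
  intro A hA e he
  simp only [inc, mem_filter] at he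
  rcases hpen e he.1 he.2 with (h | h) | h
  · simp [df, h, ch, hA]
  · simp [df, h, ch, hA]
  · simp [df, h]

lemma pen3 {v : V} (A : Finset V) : ∀ e ∈ F \ inc ends F v, df ends (insert v A) e = df ends A e := by
  intro e he
  simp only [inc, mem_sdiff, mem_filter, not_and, not_or] at he
  have h1 := he.2 he.1
  simp [df, ch, h1]

lemma pen_dc {u v : V} (huv : u ≠ v)
    (hpen : ∀ e ∈ F, (ends e).1 = v ∨ (ends e).2 = v → Joins ends e u v ∨ ends e = (v, v))
    (A : Finset V) (hvA : v ∉ A) :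
    dc ends (F \ inc ends F v) A = dc ends F (if u ∈ A then insert v A else A) := by
  have hIF : inc ends F v ⊆ F := filter_subset _ _
  rw [dc_split hIF]
  split_ifs with h
  · have e1 : dc ends (inc ends F v) (insert v A) = 0 :=
      sum_eq_zero fun e he => by rw [pen2 hpen A h e he, abs_zero]
    have e2 : dc ends (F \ inc ends F v) (insert v A) = dc ends (F \ inc ends F v) A :=
      sum_congr rfl fun e he => by rw [pen3 A e he]
    omega
  · have e1 : dc ends (inc ends F v) A = 0 :=
      sum_eq_zero fun e he => by rw [pen1 huv hpen A hvA e he, ch_not h]; simp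
    omega

lemma ch_inter (A B : Finset V) (v : V) : ch (A ∩ B) v = ch A v * ch B v := by
  by_cases h1 : v ∈ A <;> by_cases h2 : v ∈ B <;> simp [ch, h1, h2]
lemma ch_union (A B : Finset V) (v : V) : ch (A ∪ B) v = ch A v + ch B v - ch A v * ch B v := by
  by_cases h1 : v ∈ A <;> by_cases h2 : v ∈ B <;> simp [ch, h1, h2]
lemma ch_sdiff (A B : Finset V) (v : V) : ch (A \ B) v = ch A v - ch A v * ch B v := by
  by_cases h1 : v ∈ A <;> by_cases h2 : v ∈ B <;> simp [ch, h1, h2]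

lemma dc_submod (ends : E → V × V) (F : Finset E) (A B : Finset V) :
    dc ends F (A ∩ B) + dc ends F (A ∪ B) ≤ dc ends F A + dc ends F B := by
  unfold dc
  rw [← sum_add_distrib, ← sum_add_distrib]
  refine sum_le_sum fun e _ => ?_
  simp only [df, ch_inter, ch_union]
  rcases ch_01 A (ends e).1 with h1 | h1 <;> rcases ch_01 B (ends e).1 with h2 | h2 <;>
  rcases ch_01 A (ends e).2 with h3 | h3 <;> rcases ch_01 B (ends e).2 with h4 | h4 <;>
  rw [h1, h2, h3, h4] <;> norm_num

lemma dc_posi {e : E} {u v : V} (he : e ∈ F) (hj : Joins ends e u v) (A B : Finset V)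
    (hu : u ∈ A ∩ B) (hv : v ∉ A ∪ B) :
    dc ends F (A \ B) + dc ends F (B \ A) + 2 ≤ dc ends F A + dc ends F B := by
  have key : ∀ C, dc ends F C = dc ends (F.erase e) C + |ch C u - ch C v| := by
    intro C; rw [dc_erase he hj]; ring
  have h1 : dc ends (F.erase e) (A \ B) + dc ends (F.erase e) (B \ A) ≤
      dc ends (F.erase e) A + dc ends (F.erase e) B := by
    unfold dc
    rw [← sum_add_distrib, ← sum_add_distrib]
    refine sum_le_sum fun e _ => ?_
    simp only [df, ch_sdiff]
    rcases ch_01 A (ends e).1 with h1 | h1 <;> rcases ch_01 B (ends e).1 with h2 | h2 <;>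
    rcases ch_01 A (ends e).2 with h3 | h3 <;> rcases ch_01 B (ends e).2 with h4 | h4 <;>
    rw [h1, h2, h3, h4] <;> norm_num
  rw [mem_inter] at hu
  rw [mem_union, not_or] at hv
  rw [key, key, key A, key B, ch_sdiff, ch_sdiff, ch_sdiff, ch_sdiff, ch_mem hu.1, ch_mem hu.2, ch_not hv.1, ch_not hv.2]
  norm_num
  linarith

lemma par_inter (ends : E → V × V) (F : Finset E) (A B : Finset V) :
    2 ∣ dc ends F (A ∩ B) + dc ends F (A ∪ B) - (dc ends F A + dc ends F B) := by
  have h1 := dc_par ends F (A ∩ B)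
  have h2 := dc_par ends F (A ∪ B)
  have h3 := dc_par ends F A
  have h4 := dc_par ends F B
  have := sum_union_inter (s₁ := A) (s₂ := B) (f := fun v => dc ends F {v})
  omega

lemma par_diff (ends : E → V × V) (F : Finset E) (A B : Finset V) :
    2 ∣ dc ends F (A ∩ B) + dc ends F (A \ B) - dc ends F A := by
  have h1 := dc_par ends F (A ∩ B)
  have h2 := dc_par ends F (A \ B)
  have h3 := dc_par ends F A
  have := sum_inter_add_sum_sdiff A B (fun v => dc ends F {v})
  omega

lemma gam_set (hγ : ∀ v ∈ U, 2 * k ∣ γ v - k * dc ends F {v}) {A : Finset V} (hA : A ⊆ U) :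
    2 * k ∣ sm γ A - k * dc ends F A := by
  have h1 : 2 * k ∣ ∑ v ∈ A, (γ v - k * dc ends F {v}) := dvd_sum fun v hv => hγ v (hA hv)
  rw [sum_sub_distrib, ← mul_sum] at h1
  obtain ⟨q, hq⟩ := dc_par ends F A
  have h2 : 2 * k ∣ k * (dc ends F A - ∑ v ∈ A, dc ends F {v}) := ⟨q, by rw [hq]; ring⟩
  have := dvd_sub h1 h2
  unfold sm
  rwa [show ∑ v ∈ A, γ v - k * dc ends F A = ∑ v ∈ A, γ v - k * ∑ v ∈ A, dc ends F {v} -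
    k * (dc ends F A - ∑ v ∈ A, dc ends F {v}) by ring]

lemma gam_even (hk : 0 < k) {g d : ℤ} (h : 2 * k ∣ g - k * d) (hd : 2 ∣ d) : 2 * k ∣ g := by
  obtain ⟨q, rfl⟩ := hd
  have := dvd_add h (⟨q, by ring⟩ : 2 * k ∣ k * (2 * q))
  rwa [sub_add_cancel] at this

lemma gam_odd (hk : 0 < k) {g d : ℤ} (h : 2 * k ∣ g - k * d) (hd : ¬ 2 ∣ d) : nrm k g = k := by
  obtain ⟨q, hq⟩ : ∃ q, d = 2 * q + 1 := ⟨d / 2, by omega⟩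
  subst hq
  have : nrm k g = nrm k k := by
    apply nrm_congr
    have := dvd_add h (⟨q, by ring⟩ : 2 * k ∣ k * (2 * q))
    rwa [show g - k * (2 * q + 1) + k * (2 * q) = g - k by ring] at this
  rw [this, nrm_small hk hk.le le_rfl]

def OddC (k : ℤ) (ends : E → V × V) (F : Finset E) (U : Finset V) : Prop :=
  ∀ A ⊆ U, ¬ 2 ∣ dc ends F A → 3 * k - 2 ≤ dc ends F A

/-- a lift at an even vertex with two distinct neighbours -/
lemma good_lift (hkodd : ¬ 2 ∣ k) (hk : 0 < k)
    (hU : ∀ e ∈ F, (ends e).1 ∈ U ∧ (ends e).2 ∈ U) (hodd : OddC k ends F U)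
    {v : V} (hv : v ∈ U) (hev : 2 ∣ dc ends F {v})
    (h2 : ∃ e ∈ F, ∃ f ∈ F, ∃ u w, Joins ends e u v ∧ Joins ends f v w ∧ u ≠ w ∧ u ≠ v ∧ w ≠ v) :
    ∃ e ∈ F, ∃ f ∈ F, e ≠ f ∧ ∃ u w, Joins ends e u v ∧ Joins ends f v w ∧ 
      OddC k (Function.update ends e (u, w)) (F.erase f) U := by
  by_contra hcon
  push Not at hcon
  -- tight sets
  have tight : ∀ e ∈ F, ∀ f ∈ F, ∀ u w, Joins ends e u v → Joins ends f v w → u ≠ w → u ≠ v → w ≠ v →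
      ∃ A ⊆ U, v ∉ A ∧ u ∈ A ∧ w ∈ A ∧ dc ends F A = 3 * k - 2 := by
    intro e he f hf u w h1 h2' huw huv hwv
    have hef : e ≠ f := by
      rintro rfl
      rcases h1 with h | h <;> rcases h2' with h6 | h6 <;> rw [h] at h6 <;> simp at h6
      · exact huv h6.1
      · exact huw h6
      · exact huw h6
      · exact hwv h6.1.symm
    have hn := hcon e he f hf hef u w h1 h2'
    unfold OddC at hn
    push Not at hn
    obtain ⟨A, hA, ho, hlt⟩ := hn
    rw [dc_lift he hf hef h1 h2'] at ho hlt
    have hp : 2 ∣ dc ends F A - (dc ends F A - |ch A u - ch A v| - |ch A v - ch A w| + |ch A u - ch A w|) := by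
      have p1 := abs_par (ch A u - ch A v)
      have p2 := abs_par (ch A v - ch A w)
      have p3 := abs_par (ch A u - ch A w)
      omega
    have h3 := hodd A hA (by omega)
    have hmu := joins_mem hU he h1
    have hmw := joins_mem hU hf h2'
    have h4 : (ch A v = 0 ∧ ch A u = 1 ∧ ch A w = 1 ∨ ch A v = 1 ∧ ch A u = 0 ∧ ch A w = 0) ∧
        dc ends F A = 3 * k - 2 := by
      rcases ch_01 A u with e1 | e1 <;> rcases ch_01 A v with e2 | e2 <;> rcases ch_01 A w with e3 | e3 <;>
      rw [e1, e2, e3] at hlt ho ⊢ <;> norm_num at hlt ho ⊢ <;> omega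
    have chm : ∀ x, ch A x = 1 → x ∈ A := fun x hx => by
      by_contra hc; rw [ch_not hc] at hx; omega
    have chn : ∀ x, ch A x = 0 → x ∉ A := fun x hx hc => by
      rw [ch_mem hc] at hx; omega
    obtain ⟨h5 | h5, h6⟩ := h4
    · exact ⟨A, hA, chn _ h5.1, chm _ h5.2.1, chm _ h5.2.2, h6⟩
    · refine ⟨U \ A, sdiff_subset, ?_, ?_, ?_, ?_⟩
      · simp [chm _ h5.1]
      · simp [chn _ h5.2.1, hmu.1]
      · simp [chn _ h5.2.2, hmw.2]
      · rw [dc_compl hU, h6]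
  obtain ⟨e, he, f, hf, u, w, h3, h4, huw, huv, hwv⟩ := h2
  classical
  let S := U.powerset.filter fun A => v ∉ A ∧ dc ends F A = 3 * k - 2 ∧
    ∃ e ∈ F, ∃ u ∈ A, Joins ends e u v
  have hS : S.Nonempty := by
    obtain ⟨A, hA, hvA, huA, hwA, hd⟩ := tight e he f hf u w h3 h4 huw huv hwv
    exact ⟨A, by simp only [S, mem_filter, mem_powerset]; exact ⟨hA, hvA, hd, e, he, u, huA, h3⟩⟩
  obtain ⟨A, hAS, hmax⟩ := exists_max_image S card hS
  simp only [S, mem_filter, mem_powerset] at hAS hmax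
  obtain ⟨hA, hvA, hdA, e1, he1, x, hxA, hx1⟩ := hAS
  have hy : ∃ f ∈ F, ∃ y, Joins ends f v y ∧ y ≠ v ∧ y ∉ A := by
    by_contra hc
    push Not at hc
    have h5 : dc ends F (insert v A) = dc ends F A - dc ends F {v} := by
      unfold dc
      rw [← sum_sub_distrib]
      refine sum_congr rfl fun g hg => ?_
      unfold df
      by_cases q1 : (ends g).1 = v
      · by_cases q2 : (ends g).2 = v
        · rw [q1, q2]; simp
        · have := hc g hg (ends g).2 (Or.inl (Prod.ext q1 rfl)) q2
          rw [q1]; simp [ch, this, hvA, q2]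
      · by_cases q2 : (ends g).2 = v
        · have := hc g hg (ends g).1 (Or.inr (Prod.ext rfl q2)) q1
          rw [q2]; simp [ch, this, hvA, q1]
        · simp [ch, q1, q2]
    have h6 : 0 < dc ends F {v} := cross_pos (A := {v}) he1 (joins_symm hx1) (by simp) (by
      simp only [mem_singleton]; rintro rfl; exact hvA hxA)
    have h7 := hodd (insert v A) (insert_subset hv hA) (by omega)
    omega
  obtain ⟨f1, hf1, y, hy1, hyv, hyA⟩ := hy
  obtain ⟨B, hB, hvB, hxB, hyB, hdB⟩ := tight e1 he1 f1 hf1 x y hx1 hy1 (by rintro rfl; exact hyA hxA)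
    (by rintro rfl; exact hvA hxA) hyv
  have q1 := par_inter ends F A B
  have q2 := par_diff ends F A B
  have q3 := par_diff ends F B A
  rw [inter_comm B A] at q3
  by_cases hi : 2 ∣ dc ends F (A ∩ B)
  · have r1 := hodd (A \ B) (sdiff_subset.trans hA) (by omega)
    have r2 := hodd (B \ A) (sdiff_subset.trans hB) (by omega)
    have r3 := dc_posi he1 hx1 A B (mem_inter.2 ⟨hxA, hxB⟩) (by simp [hvA, hvB])
    omega
  · have r1 := hodd (A ∩ B) (inter_subset_left.trans hA) hi
    have r2 := hodd (A ∪ B) (union_subset hA hB) (by omega)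
    have r3 := dc_submod ends F A B
    have r4 := hmax (A ∪ B) ⟨union_subset hA hB, by simp [hvA, hvB], by omega, e1, he1, x,
      mem_union_left _ hxA, hx1⟩
    have r5 : A ⊂ A ∪ B := by
      refine ssubset_of_subset_of_ne subset_union_left fun h => hyA ?_
      rw [h]; exact mem_union_right _ hyB
    have := card_lt_card r5
    omega

lemma sol_small (hU : ∀ e ∈ F, (ends e).1 ∈ U ∧ (ends e).2 ∈ U) (tot : 2 * k ∣ sm γ U)
    (h : U.card ≤ 1) : Sol k ends F U γ := by
  refine ⟨fun _ => 1, fun _ => Or.inl rfl, fun v hv => ?_⟩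
  have hUv : U = {v} := by
    by_contra hc
    have := two_le hv hc
    omega
  have h1 : net ends F (fun _ => 1) {v} = 0 := by
    rw [← hUv]; exact net_univ hU (Subset.refl _) _
  rw [hUv, sm_single] at tot
  rwa [h1, sub_zero]

lemma sm0 (A : Finset V) : sm (fun _ => 0) A = 0 := by simp [sm]

lemma cfg0 (hU : ∀ e ∈ F, (ends e).1 ∈ U ∧ (ends e).2 ∈ U)
    (par : ∀ v ∈ U, 2 ∣ γ v - dc ends F {v}) (hk : 2 ≤ k)
    (tot : 2 * k ∣ sm γ U)
    (low : ∀ A ⊆ U, A.Nonempty → A ≠ U → 2 * k - 2 + nrm k (sm γ A) ≤ dc ends F A) :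
    Cfg k ends F U γ (fun _ => 0) (fun _ => 0) ∅ := by
  refine ⟨hU, par, tot, fun _ => le_rfl, fun _ => le_rfl, Or.inl rfl, ?_, ?_⟩
  · rw [sm0]; have := nrm_nonneg (show 0 < k by omega) (0 - 0); omega
  · intro A h1 h2 h3 _
    rw [sm0]; simpa using low A h1 h2 h3

/-- minimal violating set: contract and extend -/
lemma min_extend (hk : 2 ≤ k) (hU : ∀ e ∈ F, (ends e).1 ∈ U ∧ (ends e).2 ∈ U)
    (par : ∀ v ∈ U, 2 ∣ γ v - dc ends F {v}) (tot : 2 * k ∣ sm γ U)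
    (hs : ∀ v ∈ U, 2 * k - 2 + nrm k (γ v) ≤ dc ends F {v})
    (hc : ∀ A ⊆ U, A.Nonempty → A ≠ U → 2 ≤ A.card → dc ends F A < 2 * k - 2 + nrm k (sm γ A) →
      ∀ r ∈ A, Sol k (cends ends A r) F (insert r (U \ A)) (cf A r γ)) : Sol k ends F U γ := by
  let S := U.powerset.filter fun A => A.Nonempty ∧ A ≠ U ∧ dc ends F A < 2 * k - 2 + nrm k (sm γ A)
  by_cases hS : S.Nonempty
  · obtain ⟨A, hAS, hmin⟩ := exists_min_image S card hS
    simp only [S, mem_filter, mem_powerset] at hAS hmin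
    obtain ⟨hA, hne, hAU, hlt⟩ := hAS
    have h2 : 2 ≤ A.card := by
      rcases card_cases hne with ⟨x, rfl⟩ | h
      · have := hs x (hA (by simp))
        rw [sm_single] at hlt; omega
      · exact h
    obtain ⟨r, hr⟩ := hne
    refine extend (a := fun _ => 0) (b := fun _ => 0) (X := ∅) (LT_all hk A) hU par (fun _ => le_rfl)
      (fun _ => le_rfl) hA hr (Or.inl rfl) ?_ ?_ (hc A hA ⟨r, hr⟩ hAU h2 hlt r hr)
    · rw [sm0]; simpa using hlt.le
    · intro B hB hne hBA _
      rw [sm0]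
      simp only [add_zero, sub_zero]
      by_contra hcc
      have h5 := hmin B ⟨hB.trans hA, hne, fun h => hAU (Subset.antisymm hA (h ▸ hB)), by omega⟩
      have := card_lt_card (hB.ssubset_of_ne hBA)
      omega
  · refine LT_all hk U ends F γ _ _ ∅ (cfg0 hU par hk tot ?_)
    intro A h1 h2 h3
    by_contra hcc
    apply hS
    exact ⟨A, by simp only [S, mem_filter, mem_powerset]; exact ⟨h1, h2, h3, by omega⟩⟩

lemma app1 (hkodd : ¬ 2 ∣ k) (hk : 2 ≤ k) (U : Finset V) : ∀ (ends : E → V × V) (F : Finset E) (γ : V → ℤ),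
    (∀ e ∈ F, (ends e).1 ∈ U ∧ (ends e).2 ∈ U) →
    (∀ v ∈ U, 2 * k ∣ γ v - k * dc ends F {v}) → OddC k ends F U → Sol k ends F U γ := by
  have hk0 : 0 < k := by omega
  generalize hn : U.card = n
  induction n using Nat.strong_induction_on generalizing U with
  | _ n ihn =>
  intro ends F γ hU hγ hodd
  generalize hm : F.card = m
  induction m using Nat.strong_induction_on generalizing ends F γ with
  | _ m ihm =>
  have par : ∀ v ∈ U, 2 ∣ γ v - dc ends F {v} := by
    intro v hv
    have h1 : 2 ∣ γ v - k * dc ends F {v} := (dvd_mul_right 2 k).trans (hγ v hv)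
    have h2 : 2 ∣ (k - 1) * dc ends F {v} := Dvd.dvd.mul_right (by omega) _
    have := dvd_add h1 h2
    rwa [show γ v - k * dc ends F {v} + (k - 1) * dc ends F {v} = γ v - dc ends F {v} by ring] at this
  have tot : 2 * k ∣ sm γ U := by
    have := gam_set hγ (Subset.refl U)
    rwa [dc_univ hU, mul_zero, sub_zero] at this
  by_cases hc1 : U.card ≤ 1
  · exact sol_small hU tot hc1
  by_cases hev : ∃ v ∈ U, 2 ∣ dc ends F {v}
  · obtain ⟨v, hv, hev⟩ := hev
    by_cases h2 : ∃ e ∈ F, ∃ f ∈ F, ∃ u w, Joins ends e u v ∧ Joins ends f v w ∧ u ≠ w ∧ u ≠ v ∧ w ≠ v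
    · obtain ⟨e, he, f, hf, hef, u, w, h3, h4, h5⟩ := good_lift hkodd hk0 hU hodd hv hev h2
      refine sol_lift he hf hef h3 h4 (ihm _ (hm ▸ card_erase_lt_of_mem hf) _ _ _
        (ends_lift hU he hf h3 h4) ?_ h5 rfl)
      intro x hx
      rw [dc_lift he hf hef h3 h4]
      have p1 := abs_par (ch {x} u - ch {x} v)
      have p2 := abs_par (ch {x} v - ch {x} w)
      have p3 := abs_par (ch {x} u - ch {x} w)
      obtain ⟨q, hq⟩ : 2 ∣ |ch {x} u - ch {x} v| + |ch {x} v - ch {x} w| - |ch {x} u - ch {x} w| := by omega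
      have h6 : 2 * k ∣ k * (|ch {x} u - ch {x} v| + |ch {x} v - ch {x} w| - |ch {x} u - ch {x} w|) :=
        ⟨q, by rw [hq]; ring⟩
      have := dvd_add (hγ x hx) h6
      refine this.trans (dvd_of_eq ?_)
      ring
    · push Not at h2
      obtain ⟨u, huv, hpen⟩ : ∃ u, u ≠ v ∧ 
          ∀ e ∈ F, (ends e).1 = v ∨ (ends e).2 = v → Joins ends e u v ∨ ends e = (v, v) := by
        by_cases hz : ∃ e ∈ F, ∃ u, Joins ends e u v ∧ u ≠ v
        · obtain ⟨e, he, u, hj, huv⟩ := hz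
          refine ⟨u, huv, fun f hf h => ?_⟩
          rcases h with h | h
          · by_cases h5 : (ends f).2 = v
            · right; exact Prod.ext h h5
            · have : (ends f).2 = u := by
                by_contra hc
                exact h5 (h2 e he f hf u (ends f).2 hj (Or.inl (Prod.ext h rfl)) (Ne.symm hc) huv)
              left; right; exact Prod.ext h this
          · by_cases h5 : (ends f).1 = v
            · right; exact Prod.ext h5 h
            · have : (ends f).1 = u := by
                by_contra hc
                exact h5 (h2 e he f hf u (ends f).1 hj (Or.inr (Prod.ext rfl h)) (Ne.symm hc) huv)
              left; left; exact Prod.ext this h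
        · push Not at hz
          obtain ⟨u, _, huv⟩ : ∃ u ∈ U, u ≠ v := exists_mem_ne (by omega) v
          refine ⟨u, huv, fun f hf h => Or.inr ?_⟩
          rcases h with h | h
          · exact Prod.ext h (hz f hf _ (Or.inr (Prod.ext h rfl)))
          · exact Prod.ext (hz f hf _ (Or.inl (Prod.ext rfl h))) h
      have hg : 2 * k ∣ γ v := gam_even hk0 (hγ v hv) hev
      obtain ⟨ε, hε, h1⟩ := inc_orient hk0 ends F v (γ v)
        (by rw [nrm_dvd hk0 hg]; exact dc_nonneg _ _ _) (par v hv)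
      have hnet : 2 * k ∣ net ends (inc ends F v) ε {v} := by
        have := dvd_sub hg h1
        rwa [sub_sub_cancel] at this
      refine sol_del ε hε h1 (ihn _ (hn ▸ card_erase_lt_of_mem hv) _ rfl _ _ _ (hU_del hU) ?_ ?_)
      · intro x hx
        have hxv := (mem_erase.1 hx).1
        have hxU := (mem_erase.1 hx).2
        have h7 : net ends (inc ends F v) ε {x} = - (ch {x} u * net ends (inc ends F v) ε {v}) := by
          unfold net
          rw [mul_sum, ← sum_neg_distrib]
          refine sum_congr rfl fun e he => ?_
          rw [pen1 huv hpen {x} (by simpa using hxv.symm) e he]; ring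
        have h8 := pen_dc huv hpen {x} (by simpa using hxv.symm)
        have h9 : 2 ∣ dc ends F {x} - dc ends (F \ inc ends F v) {x} := by
          rw [h8]; split_ifs with h
          · have p1 := dc_par ends F (insert v {x})
            rw [sum_insert (by simpa using hxv.symm), sum_singleton] at p1
            omega
          · simp
        obtain ⟨q, hq⟩ := h9
        obtain ⟨p, hp⟩ := hnet
        rw [h7, hp]
        have h10 := dvd_add (hγ x hxU) (⟨q + ch {x} u * p, by rw [hq]; ring⟩ :
          2 * k ∣ k * (dc ends F {x} - dc ends (F \ inc ends F v) {x}) + ch {x} u * (2 * k * p))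
        refine h10.trans (dvd_of_eq ?_)
        ring
      · intro A hA ho
        have hvA : v ∉ A := fun h => by simpa using hA h
        rw [pen_dc huv hpen A hvA] at ho ⊢
        refine hodd _ ?_ ho
        split_ifs
        · exact insert_subset hv (hA.trans (erase_subset _ _))
        · exact hA.trans (erase_subset _ _)
  · push Not at hev
    refine min_extend hk hU par tot ?_ ?_
    · intro v hv
      rw [gam_odd hk0 (hγ v hv) (hev v hv)]
      have := hodd {v} (by simpa using hv) (hev v hv)
      omega
    · intro A hA hne hAU h2 hlt r hr
      refine ihn _ (hn ▸ ccard hA hr h2) _ rfl _ _ _ (cends_mem hU) ?_ ?_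
      · intro v hv
        rw [dc_pre ends F hr (by simpa using hv : {v} ⊆ insert r (U \ A))]
        by_cases hvr : v = r
        · subst hvr
          rw [pre_r hr]
          simp only [cf, if_true]
          exact gam_set hγ hA
        · rw [pre_other hvr]
          simp only [cf, hvr, if_false]
          simp only [mem_insert, hvr, false_or, mem_sdiff] at hv
          exact hγ v hv.1
      · intro B hB ho
        rw [dc_pre ends F hr hB] at ho ⊢
        exact hodd _ (pre_sub hA hB hr) ho
end PF

namespace PF
variable {V E : Type*} [DecidableEq V] [DecidableEq E]
variable {k : ℤ} {ends : E → V × V} {F : Finset E} {U X : Finset V} {γ a b : V → ℤ}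
variable {ι : Type*} [Fintype ι] [DecidableEq ι]

def App2 (E : Type*) [DecidableEq E] (ι : Type*) (k : ℤ) (U : Finset V) : Prop :=
  ∀ (ends : E → V × V) (F : Finset E) (γ : V → ℤ) (C : ι → Finset E),
    (∀ e ∈ F, (ends e).1 ∈ U ∧ (ends e).2 ∈ U) → (∀ v ∈ U, 2 ∣ γ v - dc ends F {v}) →
    2 * k ∣ sm γ U → (∀ i, C i ⊆ F) → (∀ i j, i ≠ j → Disjoint (C i) (C j)) →
    (∀ i, ∀ A ⊆ U, A.Nonempty → A ≠ U → 0 < dc ends (C i) A) → Sol k ends F U γ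

def Pc (ends : E → V × V) (C : Finset E) (U : Finset V) (v : V) : Prop :=
  ∀ A ⊆ U.erase v, A.Nonempty → A ≠ U.erase v → 0 < dc ends C A

lemma dc_mono {C D : Finset E} (h : C ⊆ D) (A : Finset V) : dc ends C A ≤ dc ends D A :=
  sum_le_sum_of_subset_of_nonneg h fun _ _ _ => abs_nonneg _

lemma conn_del {C : Finset E} {v : V} (hU : ∀ e ∈ C, (ends e).1 ∈ U ∧ (ends e).2 ∈ U)
    (hP : Pc ends C U v) (hd : dc ends C {v} ≤ 1) :
    ∀ A ⊆ U.erase v, A.Nonempty → A ≠ U.erase v → 0 < dc ends (C \ inc ends C v) A := by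
  intro A hA hne hAU
  have hD : inc ends C v ⊆ C := filter_subset _ _
  set B := U.erase v \ A with hB
  have hBne : B.Nonempty := by
    rw [hB, sdiff_nonempty]; exact fun h => hAU (Subset.antisymm hA h)
  have hBU : B ≠ U.erase v := by
    intro h
    obtain ⟨x, hx⟩ := hne
    have h1 := hA hx
    rw [← h, hB] at h1
    exact (mem_sdiff.1 h1).2 hx
  have h1 : dc ends (C \ inc ends C v) B = dc ends (C \ inc ends C v) A := dc_compl (hU_del hU)
  have h2 : dc ends (inc ends C v) A + dc ends (inc ends C v) B = dc ends (inc ends C v) {v} := by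
    unfold dc
    rw [← sum_add_distrib]
    refine sum_congr rfl fun e he => ?_
    have hvA : v ∉ A := fun h => by simpa using hA h
    have hvB : v ∉ B := fun h => by simp [hB] at h
    have hx : ∀ x ∈ U, x ≠ v → ch A x + ch B x = 1 := by
      intro x hx hxv
      by_cases h : x ∈ A
      · rw [ch_mem h, ch_not (by simp [hB, h])]; rfl
      · rw [ch_not h, ch_mem (by simp [hB, h, hx, hxv])]; rfl
    have hU' := hU e (hD he)
    simp only [inc, mem_filter] at he
    unfold df
    by_cases q1 : (ends e).1 = v
    · by_cases q2 : (ends e).2 = v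
      · rw [q1, q2]; simp
      · have := hx _ hU'.2 q2
        rw [q1, ch_not hvA, ch_not hvB, ch_mem (by simp : v ∈ ({v} : Finset V)),
          ch_not (by simpa using q2 : (ends e).2 ∉ ({v} : Finset V))]
        rcases ch_01 A (ends e).2 with h | h <;> rcases ch_01 B (ends e).2 with h' | h' <;>
        rw [h, h'] at this ⊢ <;> first | rfl | omega
    · have q2 : (ends e).2 = v := by tauto
      have := hx _ hU'.1 q1
      rw [q2, ch_not hvA, ch_not hvB, ch_mem (by simp : v ∈ ({v} : Finset V)),
          ch_not (by simpa using q1 : (ends e).1 ∉ ({v} : Finset V))]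
      rcases ch_01 A (ends e).1 with h | h <;> rcases ch_01 B (ends e).1 with h' | h' <;>
      rw [h, h'] at this ⊢ <;> first | rfl | omega
  have h3 := dc_mono (ends := ends) hD {v}
  have h4 := hP A hA hne hAU
  have h5 := hP B sdiff_subset hBne hBU
  rw [dc_split hD] at h4 h5
  have h6 := dc_nonneg ends (C \ inc ends C v) A
  omega

lemma dc_upd_not {C : Finset E} {f : E} {p : V × V} (h : f ∉ C) (A : Finset V) :
    dc (Function.update ends f p) C A = dc ends C A := by
  refine sum_congr rfl fun e he => ?_
  unfold df
  rw [Function.update_of_ne (by rintro rfl; exact h he)]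

lemma dc_upd {C : Finset E} {f : E} {x y v : V} (h : f ∈ C) (hj : Joins ends f v x) (A : Finset V) :
    dc (Function.update ends f (x, y)) C A = dc ends C A - |ch A v - ch A x| + |ch A x - ch A y| := by
  have h1 := dc_erase h hj A
  have h2 := dc_erase (ends := Function.update ends f (x, y)) h (Or.inl (by simp) : Joins _ f x y) A
  rw [dc_upd_not (by simp)] at h2
  omega

lemma two_cross {C : Finset E} {f g : E} {x y v : V} (hf : f ∈ C) (hg : g ∈ C) (hfg : f ≠ g)
    (h1 : Joins ends f v x) (h2 : Joins ends g v y) {A : Finset V} (hv : v ∉ A) (hx : x ∈ A)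
    (hy : y ∈ A) : 2 ≤ dc ends C A := by
  have e1 := dc_erase hf h1 A
  have e2 := dc_erase (mem_erase.2 ⟨hfg.symm, hg⟩) h2 A
  rw [ch_not hv, ch_mem hx] at e1
  rw [ch_not hv, ch_mem hy] at e2
  have := dc_nonneg ends ((C.erase f).erase g) A
  norm_num at e1 e2
  omega

/-- one of two edges at `v` can be rerouted to `y` -/
lemma reroute {C : Finset E} {v y : V} (hP : Pc ends C U v) (h2 : 2 ≤ dc ends C {v}) :
    ∃ f ∈ C, ∃ x, x ≠ v ∧ Joins ends f v x ∧ Pc (Function.update ends f (x, y)) C U v := by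
  obtain ⟨f, hf, v1, x, hj, hv1, hx⟩ := exists_cross (show dc ends C {v} ≠ 0 by omega)
  obtain rfl : v1 = v := by simpa using hv1
  have hxv : x ≠ v1 := by simpa using hx
  have e1 := dc_erase hf hj {v1}
  rw [ch_mem hv1, ch_not hx] at e1
  norm_num at e1
  obtain ⟨g, hg, v2, x', hj', hv2, hx'⟩ := exists_cross (show dc ends (C.erase f) {v1} ≠ 0 by omega)
  obtain rfl : v2 = v1 := by simpa using hv2
  have hxv' : x' ≠ v2 := by simpa using hx'
  have hgC := mem_of_mem_erase hg
  have hgf : f ≠ g := (mem_erase.1 hg).1.symm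
  by_contra hcon
  push Not at hcon
  have key : ∀ f ∈ C, ∀ x, x ≠ v2 → Joins ends f v2 x → 
      ∃ A ⊆ U.erase v2, x ∈ A ∧ y ∈ A ∧ dc ends C A = 1 ∧ v2 ∉ A := by
    intro f hf x hxv hj
    have := hcon f hf x hxv hj
    unfold Pc at this
    push Not at this
    obtain ⟨A, hA, hne, hAU, hle⟩ := this
    have hvA : v2 ∉ A := fun h => by simpa using hA h
    rw [dc_upd hf hj, ch_not hvA] at hle
    have hp := hP A hA hne hAU
    have : ch A x = 1 ∧ ch A y = 1 ∧ dc ends C A = 1 := by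
      rcases ch_01 A x with h | h <;> rcases ch_01 A y with h' | h' <;> rw [h, h'] at hle ⊢ <;>
      norm_num at hle ⊢ <;> omega
    refine ⟨A, hA, ?_, ?_, this.2.2, hvA⟩
    · by_contra hc; rw [ch_not hc] at this; omega
    · by_contra hc; rw [ch_not hc] at this; omega
  obtain ⟨A, hA, hxA, hyA, hdA, hvA⟩ := key f hf x hxv hj
  obtain ⟨B, hB, hxB, hyB, hdB, hvB⟩ := key g hgC x' hxv' hj'
  have hx'A : x' ∉ A := by
    intro h
    have := two_cross hf hgC hgf hj hj' hvA hxA h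
    omega
  have h1 := hP (A ∩ B) (inter_subset_left.trans hA) ⟨y, mem_inter.2 ⟨hyA, hyB⟩⟩ (by
    intro h
    have := hB hxB
    rw [← h] at this
    exact hx'A (mem_inter.1 this).1)
  have h2 := two_cross (A := A ∪ B) hf hgC hgf hj hj' (by simp [hvA, hvB]) (mem_union_left _ hxA) (mem_union_right _ hxB)
  have h3 := dc_submod ends C A B
  omega

lemma tay (hk : 2 ≤ k) {v : V} (hv : v ∈ U) (ih : App2 E ι k (U.erase v)) (n : ℕ) :
    ∀ (ends : E → V × V) (F : Finset E) (C : ι → Finset E), F.card = n →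
    (∀ e ∈ F, (ends e).1 ∈ U ∧ (ends e).2 ∈ U) → (∀ v ∈ U, 2 ∣ γ v - dc ends F {v}) →
    2 * k ∣ sm γ U → (∀ i, C i ⊆ F) → (∀ i j, i ≠ j → Disjoint (C i) (C j)) →
    (∀ i, Pc ends (C i) U v) →
    (∑ i, max (dc ends (C i) {v} - 1) 0 ≤ ((univ.filter fun i => dc ends (C i) {v} = 1).card : ℤ)) →
    (k - 1 ≤ dc ends F {v} - 2 * ∑ i, max (dc ends (C i) {v} - 1) 0) →
    Sol k ends F U γ := by
  have hk0 : 0 < k := by omega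
  induction n using Nat.strong_induction_on with
  | _ n ihn =>
  intro ends F C hn hU par tot hCF hdis hP hN hdeg
  by_cases ht : ∃ i, 2 ≤ dc ends (C i) {v}
  · obtain ⟨i, hi⟩ := ht
    have htpos : 1 ≤ ∑ i, max (dc ends (C i) {v} - 1) 0 := by
      have := single_le_sum (f := fun i => max (dc ends (C i) {v} - 1) 0) (s := univ)
        (fun _ _ => le_max_right _ _) (mem_univ i)
      have h2 := le_max_left (dc ends (C i) {v} - 1) 0
      omega
    obtain ⟨j, hj⟩ : (univ.filter fun i => dc ends (C i) {v} = 1).Nonempty := by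
      rw [← card_pos]; omega
    have hj1 : dc ends (C j) {v} = 1 := (mem_filter.1 hj).2
    have hij : i ≠ j := by rintro rfl; omega
    obtain ⟨e, he, v1, y, hey, hv1, hyv⟩ := exists_cross (show dc ends (C j) {v} ≠ 0 by omega)
    obtain rfl : v1 = v := by simpa using hv1
    obtain ⟨f, hf, x, hxv, hfx, hPi⟩ := reroute (y := y) (hP i) hi
    have hfe : f ≠ e := by
      rintro rfl; exact disjoint_left.1 (hdis i j hij) hf he
    have hfF := hCF i hf
    have heF := hCF j he
    have hfnot : ∀ l, l ≠ i → f ∉ C l := fun l hl h => disjoint_left.1 (hdis l i hl) h hf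
    have henot : ∀ l, l ≠ j → e ∉ C l := fun l hl h => disjoint_left.1 (hdis l j hl) h he
    have hxv1 : x ∉ ({v1} : Finset V) := by simpa using hxv
    set ends' := Function.update ends f (x, y) with hends'
    set C' : ι → Finset E := fun l => (C l).erase e with hC'
    have hC'ne : ∀ l, l ≠ j → C' l = C l := fun l hl => erase_eq_of_notMem (henot l hl)
    have hd : ∀ l, dc ends' (C' l) {v1} = dc ends (C l) {v1} - (if l = i then 1 else 0) - (if l = j then 1 else 0) := by
      intro l
      by_cases hlj : l = j
      · subst hlj
        have : dc ends' (C' l) {v1} = dc ends ((C l).erase e) {v1} :=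
          dc_upd_not (fun h => hfnot l hij.symm (mem_of_mem_erase h)) _
        rw [this, dc_erase he hey, ch_mem hv1, ch_not hyv]
        simp [hij.symm]
      · rw [hC'ne l hlj]
        by_cases hli : l = i
        · subst hli
          rw [hends', dc_upd hf hfx, ch_mem hv1, ch_not hxv1, ch_not hyv]
          simp [hlj]
        · rw [hends', dc_upd_not (hfnot l hli)]; simp [hli, hlj]
    have hmax : ∀ l, max (dc ends' (C' l) {v1} - 1) 0 = max (dc ends (C l) {v1} - 1) 0 - (if l = i then 1 else 0) := by
      intro l
      rw [hd l]
      by_cases hlj : l = j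
      · subst hlj; rw [hj1]; simp [hij.symm]
      · by_cases hli : l = i
        · subst hli
          simp only [hlj, if_true, if_false]
          rw [max_eq_left (by omega), max_eq_left (by omega)]; ring
        · simp [hli, hlj]
    have hsum : ∑ l, max (dc ends' (C' l) {v1} - 1) 0 = ∑ l, max (dc ends (C l) {v1} - 1) 0 - 1 := by
      rw [sum_congr rfl fun l _ => hmax l, sum_sub_distrib]; simp
    have hfx' := joins_symm hfx
    refine sol_lift hfF heF hfe hfx' hey (ihn _ (hn ▸ card_erase_lt_of_mem heF) ends' (F.erase e) C' rfl
      (ends_lift hU hfF heF hfx' hey) ?_ tot ?_ ?_ ?_ ?_ ?_)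
    · intro z hz
      have h := par z hz
      rw [hends', dc_lift hfF heF hfe hfx' hey]
      have p1 := abs_par (ch {z} x - ch {z} v1)
      have p2 := abs_par (ch {z} v1 - ch {z} y)
      have p3 := abs_par (ch {z} x - ch {z} y)
      omega
    · intro l; exact erase_subset_erase _ (hCF l)
    · intro l1 l2 h
      exact (hdis l1 l2 h).mono (erase_subset _ _) (erase_subset _ _)
    · intro l
      by_cases hlj : l = j
      · subst hlj
        intro A hA hne hAU
        have h1 := conn_del (fun e he => hU e (hCF l he)) (hP l) (by omega) A hA hne hAU
        have h2 : dc ends' (C' l) A = dc ends ((C l).erase e) A :=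
          dc_upd_not (fun h => hfnot l hij.symm (mem_of_mem_erase h)) _
        rw [h2]
        refine lt_of_lt_of_le h1 (dc_mono ?_ A)
        intro g hg
        rw [mem_sdiff] at hg
        refine mem_erase.2 ⟨?_, hg.1⟩
        rintro rfl
        apply hg.2
        simp only [inc, mem_filter]
        refine ⟨he, ?_⟩
        rcases hey with h | h <;> simp [h]
      · rw [hC'ne l hlj]
        by_cases hli : l = i
        · subst hli; exact hPi
        · intro A hA hne hAU
          rw [hends', dc_upd_not (hfnot l hli)]
          exact hP l A hA hne hAU
    · rw [hsum]
      have : ((univ.filter fun l => dc ends (C l) {v1} = 1).erase j) ⊆ univ.filter fun l => dc ends' (C' l) {v1} = 1 := by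
        intro l hl
        simp only [mem_erase, mem_filter, mem_univ, true_and] at hl ⊢
        have hli : l ≠ i := by rintro rfl; omega
        rw [hd l, hl.2]; simp [hl.1, hli]
      have := card_le_card this
      rw [card_erase_of_mem hj] at this
      omega
    · rw [hsum, hends', dc_lift hfF heF hfe hfx' hey, ch_mem hv1, ch_not hxv1, ch_not hyv]
      norm_num
      omega
  · push Not at ht
    have h0 : ∑ i, max (dc ends (C i) {v} - 1) 0 = 0 :=
      sum_eq_zero fun i _ => max_eq_right (by have := ht i; omega)
    rw [h0] at hdeg
    have hpv := par v hv
    obtain ⟨ε, hε, h1⟩ := inc_orient hk0 ends F v (γ v) (by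
      have h2 := nrm_par hk0 (γ v)
      have h3 := nrm_le_k (k := k) (γ v)
      omega) hpv
    refine sol_del ε hε h1 (ih ends (F \ inc ends F v) _ (fun i => C i \ inc ends (C i) v) (hU_del hU)
      (par_del par ε hε) (tot_del hv hU tot ε h1) ?_ ?_ ?_)
    · intro i e he
      simp only [inc, mem_sdiff, mem_filter] at he ⊢
      exact ⟨hCF i he.1, fun h => he.2 ⟨he.1, h.2⟩⟩
    · intro i j hij
      exact (hdis i j hij).mono sdiff_subset sdiff_subset
    · intro i
      exact conn_del (fun e he => hU e (hCF i he)) (hP i) (by have := ht i; omega)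

lemma app2 (hk : 2 ≤ k) (hι : (Fintype.card ι : ℤ) = 2 * k - 2) (U : Finset V) : App2 E ι k U := by
  have hk0 : 0 < k := by omega
  generalize hn : U.card = n
  induction n using Nat.strong_induction_on generalizing U with
  | _ n ihn =>
  intro ends F γ C hU par tot hCF hdis hC
  by_cases hc1 : U.card ≤ 1
  · exact sol_small hU tot hc1
  by_cases hbad : ∃ v ∈ U, dc ends F {v} < 2 * k - 2 + nrm k (γ v)
  · obtain ⟨v, hv, hlt⟩ := hbad
    have hnk := nrm_le_k (k := k) (γ v)
    have hd1 : ∀ i, 1 ≤ dc ends (C i) {v} := fun i =>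
      hC i {v} (by simpa using hv) (by simp) (single_ne (by omega) v)
    have hmax : ∀ i, max (dc ends (C i) {v} - 1) 0 = dc ends (C i) {v} - 1 := fun i =>
      max_eq_left (by have := hd1 i; omega)
    have hsum : ∑ i, dc ends (C i) {v} ≤ dc ends F {v} := by
      have : ∑ i, dc ends (C i) {v} = dc ends (univ.biUnion C) {v} := by
        unfold dc
        rw [sum_biUnion]
        intro i _ j _ hij
        exact hdis i j hij
      rw [this]
      exact dc_mono (by simpa [biUnion_subset] using hCF) _
    have hS : ∑ i, max (dc ends (C i) {v} - 1) 0 = ∑ i, dc ends (C i) {v} - (2 * k - 2) := by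
      rw [sum_congr rfl fun i _ => hmax i, sum_sub_distrib, ← hι]; simp
    have hcnt : ((univ.filter fun i => ¬ dc ends (C i) {v} = 1).card : ℤ) ≤ ∑ i, max (dc ends (C i) {v} - 1) 0 := by
      rw [card_filter]
      push_cast
      refine sum_le_sum fun i _ => ?_
      have := hd1 i
      rw [hmax i]
      split_ifs <;> omega
    have hcnt2 := card_filter_add_card_filter_not (s := (univ : Finset ι)) (fun i => dc ends (C i) {v} = 1)
    rw [card_univ] at hcnt2
    refine tay hk hv (ihn _ (hn ▸ card_erase_lt_of_mem hv) _ rfl) _ ends F C rfl hU par tot hCF hdis ?_ ?_ ?_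
    · intro i A hA hne hAU
      exact hC i A (hA.trans (erase_subset _ _)) hne (by
        rintro rfl
        simpa using hA hv)
    · omega
    · omega
  · push Not at hbad
    refine min_extend hk hU par tot hbad ?_
    intro A hA hne hAU h2 hlt r hr
    refine ihn _ (hn ▸ ccard hA hr h2) _ rfl _ _ _ C (cends_mem hU) (cpar par hA hr) ?_ hCF hdis ?_
    · rw [sm_cf γ hr (Subset.refl _), pre_full hA hr]; exact tot
    · intro i B hB hBne hBU
      rw [dc_pre ends _ hr hB]
      exact hC i _ (pre_sub hA hB hr) (pre_nonempty hBne) (pre_ne hA hB hr hBU)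
end PF

namespace PF

section konig
variable {E L R : Type*} [DecidableEq E] [DecidableEq L] [DecidableEq R]

lemma fib_card {n : ℕ} {S : Finset E} {l : E → L}
    (hl : ∀ e ∈ S, (S.filter fun x => l x = l e).card = n) (T : Finset L) (hT : T ⊆ S.image l) :
    (S.filter fun x => l x ∈ T).card = n * T.card := by
  have h0 := card_eq_sum_card_fiberwise (s := S.filter fun x => l x ∈ T) (f := l) (t := T)
    (fun x hx => (mem_filter.1 (mem_coe.1 hx)).2)
  rw [h0, mul_comm, ← smul_eq_mul, ← sum_const]
  refine sum_congr rfl fun y hy => ?_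
  obtain ⟨e, he, rfl⟩ := mem_image.1 (hT hy)
  rw [← hl e he]
  congr 1
  ext x
  simp only [mem_filter]
  constructor
  · rintro ⟨⟨h1, _⟩, h2⟩; exact ⟨h1, h2⟩
  · rintro ⟨h1, h2⟩; exact ⟨⟨h1, h2 ▸ hy⟩, h2⟩

lemma fib_sdiff {n : ℕ} {S M : Finset E} {l : E → L} (hM : M ⊆ S)
    (hl : ∀ e ∈ S, (S.filter fun x => l x = l e).card = n + 1)
    (hinj : ∀ x ∈ M, ∀ y ∈ M, l x = l y → x = y) (hsur : ∀ e ∈ S, ∃ x ∈ M, l x = l e) :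
    ∀ e ∈ S \ M, ((S \ M).filter fun x => l x = l e).card = n := by
  intro e he
  obtain ⟨m, hm, hml⟩ := hsur e (mem_sdiff.1 he).1
  have : ((S \ M).filter fun x => l x = l e) = (S.filter fun x => l x = l e).erase m := by
    ext x
    simp only [mem_filter, mem_sdiff, mem_erase]
    constructor
    · rintro ⟨⟨h1, h2⟩, h3⟩
      exact ⟨fun h => h2 (h ▸ hm), h1, h3⟩
    · rintro ⟨h1, h2, h3⟩
      exact ⟨⟨h2, fun h => h1 (hinj x h m hm (h3.trans hml.symm))⟩, h3⟩
  rw [this, card_erase_of_mem (mem_filter.2 ⟨hM hm, hml⟩), hl e (mem_sdiff.1 he).1]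
  rfl

lemma konig (l : E → L) (r : E → R) (n : ℕ) : ∀ (S : Finset E),
    (∀ e ∈ S, (S.filter fun x => l x = l e).card = n) →
    (∀ e ∈ S, (S.filter fun x => r x = r e).card = n) →
    ∃ c : E → ℕ, (∀ e ∈ S, c e < n) ∧ (∀ x ∈ S, ∀ y ∈ S, l x = l y → c x = c y → x = y) ∧
      (∀ x ∈ S, ∀ y ∈ S, r x = r y → c x = c y → x = y) := by
  induction n with
  | zero =>
    intro S hl _
    have : ∀ e, e ∉ S := by
      intro e he
      have := hl e he
      rw [card_eq_zero] at this
      have h2 : e ∈ (S.filter fun x => l x = l e) := mem_filter.2 ⟨he, rfl⟩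
      rw [this] at h2
      simp at h2
    exact ⟨fun _ => 0, fun e he => absurd he (this e), fun e he => absurd he (this e),
      fun e he => absurd he (this e)⟩
  | succ n ih =>
    intro S hl hr
    have hSL : S.card = (n + 1) * (S.image l).card := by
      rw [← fib_card hl _ (Subset.refl _)]
      congr 1; ext x; simp only [mem_filter]
      exact ⟨fun h => ⟨h, mem_image_of_mem _ h⟩, fun h => h.1⟩
    have hSR : S.card = (n + 1) * (S.image r).card := by
      rw [← fib_card hr _ (Subset.refl _)]
      congr 1; ext x; simp only [mem_filter]
      exact ⟨fun h => ⟨h, mem_image_of_mem _ h⟩, fun h => h.1⟩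
    have hLR : (S.image l).card = (S.image r).card :=
      Nat.eq_of_mul_eq_mul_left (Nat.succ_pos n) (hSL.symm.trans hSR)
    let t : {x // x ∈ S.image l} → Finset R := fun x => (S.filter fun e => l e = x.1).image r
    have hall : ∀ s : Finset {x // x ∈ S.image l}, s.card ≤ (s.biUnion t).card := by
      intro s
      have h1 := fib_card hl (s.map (Function.Embedding.subtype _)) (by
        intro x hx
        obtain ⟨y, _, rfl⟩ := mem_map.1 hx
        exact y.2)
      have h2 := fib_card hr (s.biUnion t) (by
        intro y hy
        obtain ⟨x, _, hy⟩ := mem_biUnion.1 hy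
        obtain ⟨e, he, rfl⟩ := mem_image.1 hy
        exact mem_image_of_mem _ (mem_filter.1 he).1)
      have h3 : (S.filter fun x => l x ∈ s.map (Function.Embedding.subtype _)) ⊆
          S.filter fun x => r x ∈ s.biUnion t := by
        intro e he
        rw [mem_filter] at he ⊢
        refine ⟨he.1, ?_⟩
        obtain ⟨y, hy, hy2⟩ := mem_map.1 he.2
        refine mem_biUnion.2 ⟨y, hy, mem_image.2 ⟨e, mem_filter.2 ⟨he.1, hy2.symm⟩, rfl⟩⟩
      have h4 := card_le_card h3
      rw [h1, h2, card_map] at h4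
      exact Nat.le_of_mul_le_mul_left h4 (Nat.succ_pos n)
    obtain ⟨f, hf, hft⟩ := (all_card_le_biUnion_card_iff_exists_injective t).1 hall
    have : ∀ x, ∃ e ∈ S, l e = x.1 ∧ r e = f x := by
      intro x
      obtain ⟨e, he, h⟩ := mem_image.1 (hft x)
      exact ⟨e, (mem_filter.1 he).1, (mem_filter.1 he).2, h⟩
    choose g hgS hgl hgr using this
    let M := (univ : Finset {x // x ∈ S.image l}).image g
    have hMS : M ⊆ S := by
      intro e he
      obtain ⟨x, _, rfl⟩ := mem_image.1 he
      exact hgS x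
    have hinjl : ∀ x ∈ M, ∀ y ∈ M, l x = l y → x = y := by
      intro x hx y hy h
      obtain ⟨x', _, rfl⟩ := mem_image.1 hx
      obtain ⟨y', _, rfl⟩ := mem_image.1 hy
      rw [hgl, hgl] at h
      rw [Subtype.ext h]
    have hinjr : ∀ x ∈ M, ∀ y ∈ M, r x = r y → x = y := by
      intro x hx y hy h
      obtain ⟨x', _, rfl⟩ := mem_image.1 hx
      obtain ⟨y', _, rfl⟩ := mem_image.1 hy
      rw [hgr, hgr] at h
      rw [hf h]
    have hsurl : ∀ e ∈ S, ∃ x ∈ M, l x = l e := fun e he =>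
      ⟨g ⟨l e, mem_image_of_mem _ he⟩, mem_image_of_mem _ (mem_univ _), hgl _⟩
    have hMcard : M.card = (S.image l).card := by
      rw [card_image_of_injective]
      · simp
      · intro x y h
        apply Subtype.ext
        rw [← hgl, ← hgl, h]
    have himg : M.image r = S.image r := by
      apply eq_of_subset_of_card_le (image_subset_image hMS)
      rw [card_image_of_injOn (fun x hx y hy h => hinjr x hx y hy h), hMcard, hLR]
    have hsurr : ∀ e ∈ S, ∃ x ∈ M, r x = r e := by
      intro e he
      have := mem_image_of_mem r he
      rw [← himg] at this
      obtain ⟨x, hx, h⟩ := mem_image.1 this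
      exact ⟨x, hx, h⟩
    obtain ⟨c, hc1, hc2, hc3⟩ := ih (S \ M) (fib_sdiff hMS hl hinjl hsurl) (fib_sdiff hMS hr hinjr hsurr)
    have key : ∀ {Q : Type _} (p : E → Q), (∀ x ∈ M, ∀ y ∈ M, p x = p y → x = y) →
        (∀ x ∈ S \ M, ∀ y ∈ S \ M, p x = p y → c x = c y → x = y) →
        ∀ x ∈ S, ∀ y ∈ S, p x = p y → (if x ∈ M then n else c x) = (if y ∈ M then n else c y) → x = y := by
      intro Q p h1 h2 x hx y hy hp hcc
      by_cases hxM : x ∈ M <;> by_cases hyM : y ∈ M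
      · exact h1 x hxM y hyM hp
      · rw [if_pos hxM, if_neg hyM] at hcc
        have := hc1 y (mem_sdiff.2 ⟨hy, hyM⟩); omega
      · rw [if_neg hxM, if_pos hyM] at hcc
        have := hc1 x (mem_sdiff.2 ⟨hx, hxM⟩); omega
      · rw [if_neg hxM, if_neg hyM] at hcc
        exact h2 x (mem_sdiff.2 ⟨hx, hxM⟩) y (mem_sdiff.2 ⟨hy, hyM⟩) hp hcc
    refine ⟨fun e => if e ∈ M then n else c e, ?_, key l hinjl hc2, ?_⟩
    · intro e he
      by_cases h : e ∈ M
      · simp [h]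
      · simp only [h, if_false]
        have := hc1 e (mem_sdiff.2 ⟨he, h⟩); omega
    · intro x hx y hy hp hcc
      by_cases hxM : x ∈ M <;> by_cases hyM : y ∈ M
      · exact hinjr x hxM y hyM hp
      · simp only [if_pos hxM, if_neg hyM] at hcc
        have := hc1 y (mem_sdiff.2 ⟨hy, hyM⟩); omega
      · simp only [if_neg hxM, if_pos hyM] at hcc
        have := hc1 x (mem_sdiff.2 ⟨hx, hxM⟩); omega
      · simp only [if_neg hxM, if_neg hyM] at hcc
        exact hc3 x (mem_sdiff.2 ⟨hx, hxM⟩) y (mem_sdiff.2 ⟨hy, hyM⟩) hp hcc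
end konig

section side
variable {V E : Type*} [DecidableEq V] [DecidableEq E] [Fintype E]

lemma exists_rank (p : E → V) : ∃ rk : E → ℕ,
    (∀ e, rk e < (univ.filter fun x => p x = p e).card) ∧
    (∀ e f, p e = p f → rk e = rk f → e = f) ∧
    ∀ v, ∀ n < (univ.filter fun x => p x = v).card, ∃ e, p e = v ∧ rk e = n := by
  have h : ∀ v, ∃ g : E → ℕ, ∀ e, p e = v → g e < (univ.filter fun x => p x = v).card ∧
      (∀ f, p f = v → g e = g f → e = f) := by
    intro v
    let q := (univ.filter fun x => p x = v).equivFin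
    refine ⟨fun e => if h : e ∈ (univ.filter fun x => p x = v) then q ⟨e, h⟩ else 0, fun e he => ?_⟩
    have hm : e ∈ (univ.filter fun x => p x = v) := by simp [he]
    refine ⟨by simp only [hm, dif_pos]; exact (q ⟨e, hm⟩).2, fun f hf hef => ?_⟩
    have hm' : f ∈ (univ.filter fun x => p x = v) := by simp [hf]
    simp only [hm, hm', dif_pos] at hef
    have := q.injective (Fin.ext hef)
    exact congrArg Subtype.val this
  choose g hg using h
  refine ⟨fun e => g (p e) e, fun e => (hg _ e rfl).1, fun e f hp h => ?_, fun v n hn => ?_⟩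
  · simp only [← hp] at h
    exact (hg _ e rfl).2 f hp.symm h
  · have : (univ.filter fun x => p x = v).image (g v) = range (univ.filter fun x => p x = v).card := by
      apply eq_of_subset_of_card_le
      · intro m hm
        obtain ⟨e, he, rfl⟩ := mem_image.1 hm
        exact mem_range.2 (hg v e (mem_filter.1 he).2).1
      · rw [card_range, card_image_of_injOn]
        intro e he f hf h
        exact (hg v e (mem_filter.1 he).2).2 f (mem_filter.1 hf).2 h
    have h2 := mem_range.2 hn
    rw [← this] at h2
    obtain ⟨e, he, h⟩ := mem_image.1 h2
    have hp := (mem_filter.1 he).2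
    exact ⟨e, hp, by simp only [hp]; exact h⟩

lemma side {k : ℕ} (hk : 0 < k) (p : E → V) (r : V → ℕ)
    (hr : ∀ v, r v = (univ.filter fun x => p x = v).card % k) (D : Finset (V × ℕ))
    (hD : ∀ v t, (v, t) ∈ D ↔ 0 < r v ∧ t + r v < k) :
    ∃ l : E ⊕ (V × ℕ) → V × ℕ,
      (∀ x ∈ (univ : Finset E).disjSum D,
        (((univ : Finset E).disjSum D).filter fun y => l y = l x).card = k) ∧
      ∀ c : E ⊕ (V × ℕ) → ℕ, (∀ x ∈ (univ : Finset E).disjSum D, c x < k) →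
        (∀ x ∈ (univ : Finset E).disjSum D, ∀ y ∈ (univ : Finset E).disjSum D,
          l x = l y → c x = c y → x = y) →
        ∀ v, ∀ i < k, (univ.filter fun e => p e = v ∧ c (Sum.inl e) = i).card =
          (univ.filter fun x => p x = v).card / k +
            (if 0 < r v ∧ ∀ q ∈ D, q.1 = v → c (Sum.inr q) ≠ i then 1 else 0) := by
  obtain ⟨rk, h1, h2, h3⟩ := exists_rank p
  set d : V → ℕ := fun v => (univ.filter fun x => p x = v).card with hd
  have hdr : ∀ v, d v = k * (d v / k) + r v := fun v => by rw [hr v]; exact (Nat.div_add_mod _ _).symm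
  have hrk : ∀ v, r v < k := fun v => by rw [hr v]; exact Nat.mod_lt _ hk
  set S := (univ : Finset E).disjSum D with hS
  let l : E ⊕ (V × ℕ) → V × ℕ := fun x => match x with
    | Sum.inl e => (p e, rk e / k)
    | Sum.inr q => (q.1, d q.1 / k)
  -- real fibre sizes
  have real : ∀ v j, (univ.filter fun e => p e = v ∧ rk e / k = j).card = min (d v) ((j + 1) * k) - j * k := by
    intro v j
    rw [← Nat.card_Ico]
    refine card_bij (fun e _ => rk e) ?_ ?_ ?_
    · intro e he
      obtain ⟨hp, hj⟩ := (mem_filter.1 he).2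
      rw [mem_Ico, lt_min_iff]
      have h5 := h1 e
      rw [hp] at h5
      refine ⟨?_, h5, ?_⟩
      · rw [← hj]; exact Nat.div_mul_le_self _ _
      · rw [← hj]; exact (Nat.div_lt_iff_lt_mul hk).1 (Nat.lt_succ_self _)
    · intro e he f hf h
      exact h2 e f ((mem_filter.1 he).2.1.trans (mem_filter.1 hf).2.1.symm) h
    · intro n hn
      rw [mem_Ico, lt_min_iff] at hn
      obtain ⟨e, he, hen⟩ := h3 v n hn.2.1
      refine ⟨e, mem_filter.2 ⟨mem_univ _, he, ?_⟩, hen⟩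
      rw [hen]
      exact Nat.div_eq_of_lt_le hn.1 hn.2.2
  have dummy : ∀ v, (D.filter fun q => q.1 = v).card = if 0 < r v then k - r v else 0 := by
    intro v
    have : (D.filter fun q => q.1 = v) = (range (if 0 < r v then k - r v else 0)).image fun t => (v, t) := by
      ext ⟨w, t⟩
      simp only [mem_filter, hD, mem_image, mem_range, Prod.mk.injEq]
      constructor
      · rintro ⟨⟨h4, h5⟩, rfl⟩
        refine ⟨t, ?_, rfl, rfl⟩
        rw [if_pos h4]; omega
      · rintro ⟨t', h4, rfl, rfl⟩
        split_ifs at h4 with h5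
        · exact ⟨⟨h5, by omega⟩, rfl⟩
        · omega
    rw [this, card_image_of_injective _ (fun _ _ h => (Prod.mk.inj h).2), card_range]
  have split : ∀ v j, (S.filter fun y => l y = (v, j)).card =
      (min (d v) ((j + 1) * k) - j * k) + (if j = d v / k then (if 0 < r v then k - r v else 0) else 0) := by
    intro v j
    have : (S.filter fun y => l y = (v, j)) =
      (univ.filter fun e => p e = v ∧ rk e / k = j).disjSum (D.filter fun q => q.1 = v ∧ d v / k = j) := by
      ext x
      rcases x with e | q
      · simp [hS, l]
      · simp only [hS, l, mem_filter, inr_mem_disjSum, Prod.mk.injEq]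
        constructor
        · rintro ⟨h4, rfl, h5⟩; exact ⟨h4, rfl, h5⟩
        · rintro ⟨h4, rfl, h5⟩; exact ⟨h4, rfl, h5⟩
    rw [this, card_disjSum, real]
    congr 1
    split_ifs with h4 h5
    · subst h4; simp only [and_true]; rw [dummy, if_pos h5]
    · subst h4; simp only [and_true]; rw [dummy, if_neg h5]
    · rw [card_eq_zero, filter_eq_empty_iff]
      rintro q _ ⟨_, h⟩; exact h4 h.symm
  have full : ∀ v j, j * k < d v → (S.filter fun y => l y = (v, j)).card = k := by
    intro v j hj
    rw [split]
    have h4 := hdr v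
    have h5 := hrk v
    have hle : j ≤ d v / k := by
      rw [Nat.le_div_iff_mul_le hk]; omega
    rcases Nat.lt_or_eq_of_le hle with h6 | h6
    · have : (j + 1) * k ≤ d v := (Nat.le_div_iff_mul_le hk).1 h6
      rw [if_neg (by omega), min_eq_right this, Nat.add_mul]; omega
    · have e1 : j * k = k * (d v / k) := by rw [h6, mul_comm]
      have hr0 : 0 < r v := by omega
      rw [if_pos h6, if_pos hr0, min_eq_left (by rw [Nat.add_mul]; omega)]
      omega
  have inS : ∀ e, Sum.inl e ∈ S := fun e => by simp [hS]
  have lin : ∀ e, rk e / k * k < d (p e) := fun e =>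
    lt_of_le_of_lt (Nat.div_mul_le_self _ _) (h1 e)
  refine ⟨l, ?_, ?_⟩
  · intro x hx
    rcases x with e | q
    · exact full _ _ (lin e)
    · rw [hS, inr_mem_disjSum] at hx
      have h4 := (hD q.1 q.2).1 hx
      refine full _ _ ?_
      have := hdr q.1
      rw [mul_comm]; omega
  · intro c hc hinj v i hi
    have surj : ∀ j, j * k < d v → ∃ y ∈ S, l y = (v, j) ∧ c y = i := by
      intro j hj
      have : (S.filter fun y => l y = (v, j)).image c = range k := by
        apply eq_of_subset_of_card_le
        · intro m hm
          obtain ⟨e, he, rfl⟩ := mem_image.1 hm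
          exact mem_range.2 (hc e (mem_filter.1 he).1)
        · rw [card_range, card_image_of_injOn, full v j hj]
          intro e he f hf h
          have he' := mem_filter.1 he
          have hf' := mem_filter.1 hf
          exact hinj e he'.1 f hf'.1 (he'.2.trans hf'.2.symm) h
      have h2 := mem_range.2 hi
      rw [← this] at h2
      obtain ⟨y, hy, h⟩ := mem_image.1 h2
      exact ⟨y, (mem_filter.1 hy).1, (mem_filter.1 hy).2, h⟩
    rw [← card_range ((univ.filter fun x => p x = v).card / k + _)]
    refine card_bij (fun e _ => rk e / k) ?_ ?_ ?_
    · intro e he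
      obtain ⟨hp, hci⟩ := (mem_filter.1 he).2
      subst hp
      have h4 := lin e
      have h5 := hdr (p e)
      have hle : rk e / k ≤ d (p e) / k := by
        rw [Nat.le_div_iff_mul_le hk]; omega
      rw [mem_range]
      rcases Nat.lt_or_eq_of_le hle with h6 | h6
      · exact Nat.lt_of_lt_of_le h6 (Nat.le_add_right _ _)
      · rw [if_pos]
        · exact Nat.lt_succ_of_le hle
        · refine ⟨?_, ?_⟩
          · rw [h6, mul_comm] at h4; omega
          · intro q ht hq hct
            have := hinj (Sum.inl e) (inS e) (Sum.inr q) (by rw [hS, inr_mem_disjSum]; exact ht)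
              (by simp only [l]; rw [h6, hq]) (hci.trans hct.symm)
            simp at this
    · intro e he f hf h
      obtain ⟨hp, hci⟩ := (mem_filter.1 he).2
      obtain ⟨hp', hci'⟩ := (mem_filter.1 hf).2
      have := hinj (Sum.inl e) (inS e) (Sum.inl f) (inS f) (by simp only [l]; rw [h, hp, hp']) (hci.trans hci'.symm)
      exact Sum.inl.inj this
    · intro j hj
      rw [mem_range] at hj
      have h5 := hdr v
      have hj' : j < d v / k ∨ j = d v / k ∧ 0 < r v ∧ ∀ q ∈ D, q.1 = v → c (Sum.inr q) ≠ i := by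
        split_ifs at hj with h
        · rcases Nat.lt_or_eq_of_le (Nat.le_of_lt_succ hj) with h6 | h6
          · exact Or.inl h6
          · exact Or.inr ⟨h6, h⟩
        · exact Or.inl hj
      have hjk : j * k < d v := by
        rcases hj' with h6 | ⟨h6, h7, _⟩
        · have : (j + 1) * k ≤ d v := (Nat.le_div_iff_mul_le hk).1 h6
          rw [Nat.add_mul] at this; omega
        · rw [h6, mul_comm]; omega
      obtain ⟨y, hy, hly, hcy⟩ := surj j hjk
      rcases y with e | q
      · simp only [l, Prod.mk.injEq] at hly
        exact ⟨e, mem_filter.2 ⟨mem_univ _, hly.1, hcy⟩, hly.2⟩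
      · exfalso
        rw [hS, inr_mem_disjSum] at hy
        simp only [l, Prod.mk.injEq] at hly
        obtain ⟨q1, q2⟩ := q
        obtain ⟨rfl, hly⟩ := hly
        simp only at hly
        rcases hj' with h6 | ⟨h6, h7, h8⟩
        · exact absurd hly (Nat.ne_of_gt h6)
        · exact h8 _ hy rfl hcy

lemma color [Fintype V] {k : ℕ} (hk : 0 < k) (tl hd : E → V)
    (h : ∀ v, (univ.filter fun x => tl x = v).card % k = (univ.filter fun x => hd x = v).card % k) :
    ∃ c : E → Fin k, ∀ v i, ∃ s : ℕ, s ≤ 1 ∧ (s = 1 → 0 < (univ.filter fun x => tl x = v).card % k) ∧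
      (univ.filter fun e => tl e = v ∧ c e = i).card = (univ.filter fun x => tl x = v).card / k + s ∧
      (univ.filter fun e => hd e = v ∧ c e = i).card = (univ.filter fun x => hd x = v).card / k + s := by
  let r : V → ℕ := fun v => (univ.filter fun x => tl x = v).card % k
  let D : Finset (V × ℕ) := (univ ×ˢ range k).filter fun q => 0 < r q.1 ∧ q.2 + r q.1 < k
  have hD : ∀ v t, (v, t) ∈ D ↔ 0 < r v ∧ t + r v < k := by
    intro v t
    simp only [D, mem_filter, mem_product, mem_univ, true_and, mem_range]
    constructor
    · exact fun h => h.2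
    · exact fun h => ⟨by omega, h⟩
  obtain ⟨l, hl, hl2⟩ := side hk tl r (fun _ => rfl) D hD
  obtain ⟨l', hl', hl2'⟩ := side hk hd r (fun v => h v) D hD
  obtain ⟨c, hc1, hc2, hc3⟩ := konig l l' k _ hl hl'
  refine ⟨fun e => ⟨c (Sum.inl e), hc1 _ (by simp)⟩, fun v i => ?_⟩
  have e1 := hl2 c hc1 hc2 v i i.2
  have e2 := hl2' c hc1 hc3 v i i.2
  refine ⟨if 0 < r v ∧ ∀ q ∈ D, q.1 = v → c (Sum.inr q) ≠ i then 1 else 0, ?_, ?_, ?_, ?_⟩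
  rotate_left 2
  · simp only [Fin.ext_iff]; exact e1
  · simp only [Fin.ext_iff]; exact e2
  · split_ifs <;> omega
  · by_cases h4 : 0 < r v ∧ ∀ q ∈ D, q.1 = v → c (Sum.inr q) ≠ i
    · intro _; exact h4.1
    · rw [if_neg h4]; intro h5; exact absurd h5 (by norm_num)
end side
end PF

namespace PF
section fin
variable {V E : Type*} [DecidableEq V] [Fintype E] [DecidableEq E]

lemma cut_dc (ends : E → V × V) (X : Finset V) : (cutCard ends X : ℤ) = dc ends univ X := by
  unfold cutCard dc
  rw [card_filter]
  push_cast
  refine sum_congr rfl fun e _ => ?_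
  unfold df ch
  by_cases h1 : (ends e).1 ∈ X <;> by_cases h2 : (ends e).2 ∈ X <;> simp [h1, h2]

lemma tree_cross [Fintype V] {ends : E → V × V} {T : Finset E} (hT : IsSpanningTree ends T)
    {A : Finset V} (hA : A.Nonempty) (hA' : A ≠ univ) : 0 < dc ends T A := by
  obtain ⟨a, ha⟩ := hA
  obtain ⟨b, hb⟩ : ∃ b, b ∉ A := by
    by_contra h
    push Not at h
    exact hA' (eq_univ_iff_forall.2 h)
  by_contra hc
  apply hb
  have := hT.1 a b
  induction this with
  | refl => exact ha
  | tail _ h ih =>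
    obtain ⟨e, he, hj⟩ := h
    by_contra hn
    exact hc (cross_pos he hj (by_contra fun h => h (ih h)) hn)

lemma exists_sol [Fintype V] (ends : E → V × V) (k : ℕ) (hk : Odd k) (hk3 : 3 ≤ k)
    (hconn : (∀ X : Finset V, Odd (cutCard ends X) → 3 * k - 2 ≤ cutCard ends X) ∨
      TreeConn ends (2 * k - 2)) :
    Sol (k : ℤ) ends univ univ (fun v => (k : ℤ) * dc ends univ {v}) := by
  have hU : ∀ e ∈ (univ : Finset E), (ends e).1 ∈ (univ : Finset V) ∧ (ends e).2 ∈ (univ : Finset V) :=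
    fun e _ => ⟨mem_univ _, mem_univ _⟩
  have hγ : ∀ v ∈ (univ : Finset V), 2 * (k : ℤ) ∣ (fun v => (k : ℤ) * dc ends univ {v}) v - k * dc ends univ {v} :=
    fun v _ => by simp
  obtain ⟨m, hm⟩ := hk
  rcases hconn with h | ⟨Ts, hdis, hT⟩
  · refine app1 (by omega) (by omega) univ ends univ _ hU hγ ?_
    intro A _ hodd
    rw [← cut_dc] at hodd ⊢
    have := h A (by rw [Nat.odd_iff]; omega)
    omega
  · refine app2 (ι := Fin (2 * k - 2)) (by omega) (by rw [Fintype.card_fin]; omega) univ ends univ _ Ts hU ?_ ?_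
      (fun i => subset_univ _) hdis (fun i A _ h1 h2 => tree_cross (hT i) h1 h2)
    · intro v _
      refine ⟨m * dc ends univ {v}, ?_⟩
      simp only [hm]; push_cast; ring
    · have := gam_set hγ (Subset.refl univ)
      rwa [dc_univ hU, mul_zero, sub_zero] at this

lemma main [Fintype V] (ends : E → V × V) (k : ℕ) (hk : Odd k)
    (hconn : (∀ X : Finset V, Odd (cutCard ends X) → 3 * k - 2 ≤ cutCard ends X) ∨
      TreeConn ends (2 * k - 2)) :
    ∃ c : E → Fin k, ∀ v : V, ∀ i : Fin k,
      mdeg ends (univ.filter fun e => c e = i) v ≡ mdeg ends univ v [MOD 2] ∧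
      |((mdeg ends (univ.filter fun e => c e = i) v : ℝ)) -
        (mdeg ends univ v : ℝ) / (k : ℝ)| < 2 := by
  by_cases hk1 : k = 1
  · subst hk1
    refine ⟨fun _ => 0, fun v i => ?_⟩
    have hi : i = 0 := Subsingleton.elim _ _
    subst hi
    simp [Nat.ModEq]
  have hk0 : 0 < k := hk.pos
  have hk3 : 3 ≤ k := by obtain ⟨m, hm⟩ := hk; omega
  obtain ⟨ε, hε, hs⟩ := exists_sol ends k hk hk3 hconn
  let tl : E → V := fun e => if ε e = 1 then (ends e).1 else (ends e).2
  let hd : E → V := fun e => if ε e = 1 then (ends e).2 else (ends e).1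
  have hnet : ∀ v, net ends univ ε {v} = ((univ.filter fun x => tl x = v).card : ℤ) -
      ((univ.filter fun x => hd x = v).card : ℤ) := by
    intro v
    rw [card_filter, card_filter]
    push_cast
    rw [← sum_sub_distrib]
    refine sum_congr rfl fun e _ => ?_
    rcases hε e with h | h <;> simp [df, ch, tl, hd, h]
  have hdeg : ∀ (S : Finset E) v, mdeg ends S v =
      (S.filter fun x => tl x = v).card + (S.filter fun x => hd x = v).card := by
    intro S v
    unfold mdeg
    simp only [card_filter]
    rw [← sum_add_distrib, ← sum_add_distrib]
    refine sum_congr rfl fun e _ => ?_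
    rcases hε e with h | h
    · simp [tl, hd, h]
    · simp [tl, hd, h, add_comm]
  have hmod : ∀ v, (univ.filter fun x => tl x = v).card % k = (univ.filter fun x => hd x = v).card % k := by
    intro v
    have h1 := hs v (mem_univ _)
    rw [hnet] at h1
    have h2 : (k : ℤ) ∣ (k : ℤ) * dc ends univ {v} - (((univ.filter fun x => tl x = v).card : ℤ) -
      ((univ.filter fun x => hd x = v).card : ℤ)) := dvd_trans (dvd_mul_left _ _) h1
    have h3 := (dvd_sub_right (dvd_mul_right (k : ℤ) _)).1 h2
    exact (Nat.modEq_iff_dvd.2 h3).symm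
  obtain ⟨c, hc⟩ := color hk0 tl hd hmod
  refine ⟨c, fun v i => ?_⟩
  obtain ⟨s, hs1, hs2, e1, e2⟩ := hc v i
  have h3 := hmod v
  rw [hdeg, hdeg, filter_filter, filter_filter]
  simp only [and_comm (b := tl _ = v), and_comm (b := hd _ = v)]
  rw [e1, e2]
  have d1 := Nat.div_add_mod (univ.filter fun x => tl x = v).card k
  have d2 := Nat.div_add_mod (univ.filter fun x => hd x = v).card k
  have hr := Nat.mod_lt (univ.filter fun x => tl x = v).card hk0
  rw [← h3] at d2
  generalize (univ.filter fun x => tl x = v).card % k = r at *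
  generalize (univ.filter fun x => tl x = v).card / k = q1 at *
  generalize (univ.filter fun x => hd x = v).card / k = q2 at *
  rw [← d1, ← d2]
  constructor
  · obtain ⟨m, rfl⟩ := hk
    unfold Nat.ModEq
    have : (2 * m + 1) * q1 + r + ((2 * m + 1) * q2 + r) = q1 + q2 + 2 * (m * q1 + m * q2 + r) := by ring
    omega
  · have hkr : (0 : ℝ) < k := by exact_mod_cast hk0
    have hrr : (r : ℝ) < k := by exact_mod_cast hr
    have hr0 : (0 : ℝ) ≤ r := by positivity
    have : ((q1 + s + (q2 + s) : ℕ) : ℝ) - ((k * q1 + r + (k * q2 + r) : ℕ) : ℝ) / k =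
        2 * (s - r / k) := by
      push_cast; field_simp; ring
    rw [this]
    have h4 : (r : ℝ) / k < 1 := (div_lt_one hkr).2 hrr
    have h5 : (0 : ℝ) ≤ r / k := by positivity
    rcases Nat.le_one_iff_eq_zero_or_eq_one.1 hs1 with h | h
    · subst h; rw [abs_lt]; constructor <;> push_cast <;> linarith
    · have h6 : (0 : ℝ) < r := by exact_mod_cast hs2 h
      have h7 : (0 : ℝ) < r / k := by positivity
      subst h; rw [abs_lt]; constructor <;> push_cast <;> linarith
end fin
end PF

/-- Parity factorization of odd-`(3k−2)`-edge-connected (or `(2k−2)`-tree-connected)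
multigraphs, for odd `k`. -/
theorem parity_factorization_odd_k [Fintype V] [Fintype E] [DecidableEq V]
    (ends : E → V × V) (k : ℕ) (hk : Odd k)
    (hconn : (∀ X : Finset V, Odd (cutCard ends X) → 3 * k - 2 ≤ cutCard ends X) ∨
      TreeConn ends (2 * k - 2)) :
    ∃ c : E → Fin k, ∀ v : V, ∀ i : Fin k,
      mdeg ends (univ.filter fun e => c e = i) v ≡ mdeg ends univ v [MOD 2] ∧
      |((mdeg ends (univ.filter fun e => c e = i) v : ℝ)) -
        (mdeg ends univ v : ℝ) / (k : ℝ)| < 2 := by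
  classical
  exact PF.main ends k hk hconn
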